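/- arXiv:2403.18675 — 2 statements merged into one kernel-verified Lean document; each statement's English description precedes it below -/
import Mathlib

section
/- Characterization of submanifolds with boundary in non-critical low codimension: let 1 ≤ k ≤ n−1, let O ⊆ ℍ^n be open and S ⊆ O with O ∩ ∂S ≠ ∅ (where ∂S := S̄∖S). Then the following are equivalent: (i) S is a k-codimensional C¹_ℍ-regular submanifold with boundary in O; (ii) O ∩ S is a nonempty k-codimensional C¹_ℍ-regular submanifold and for every p ∈ O ∩ ∂S there exist a neighbourhood U of p and functions f₁,…,f_{k+1} ∈ C¹_ℍ(U) such that ∇_ℍf₁,…,∇_ℍf_{k+1} are linearly independent in U, U ∩ S = {q ∈ U : f₁(q)=⋯=f_k(q)=0, f_{k+1}(q)>0}, and f_{k+1}(p)=0. -/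
open MeasureTheory Topology Filter Set ENNReal

noncomputable section
namespace Heis

/-- Points of the `n`-th Heisenberg group `ℍⁿ ≡ ℝⁿ × ℝⁿ × ℝ`, `p = (x, y, t)`. -/
abbrev Hpt (n : ℕ) : Type := (Fin n → ℝ) × (Fin n → ℝ) × ℝ

variable {n : ℕ}

/-- The Heisenberg group operation. -/
def hmul (p q : Hpt n) : Hpt n :=
  (p.1 + q.1, p.2.1 + q.2.1,
    p.2.2 + q.2.2 + (∑ j, p.1 j * q.2.1 j) / 2 - (∑ j, q.1 j * p.2.1 j) / 2)

/-- Group inverse. -/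
def hinv (p : Hpt n) : Hpt n := (-p.1, -p.2.1, -p.2.2)

/-- Anisotropic dilations `δ_λ(x,y,t) = (λx, λy, λ²t)`. -/
def hdil (l : ℝ) (p : Hpt n) : Hpt n := (l • p.1, l • p.2.1, l ^ 2 * p.2.2)

/-- The value at `p` of the `j`-th left invariant frame field `X₁,…,Xₙ,Y₁,…,Yₙ,T`,
expressed in the coordinates of `ℝ^{2n+1}`. -/
def frameVec (j : Fin (2*n+1)) (p : Hpt n) : Hpt n :=
  if h : (j : ℕ) < n then
    (Pi.single (⟨j, h⟩ : Fin n) 1, 0, -(p.2.1 ⟨j, h⟩) / 2)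
  else if h' : (j : ℕ) < 2*n then
    (0, Pi.single (⟨(j:ℕ) - n, by omega⟩ : Fin n) 1, p.1 ⟨(j:ℕ) - n, by omega⟩ / 2)
  else (0, 0, 1)

/-- Inclusion of horizontal indices. -/
def hIdx (j : Fin (2*n)) : Fin (2*n+1) := Fin.castLE (by omega) j

/-- Horizontal gradient `∇_ℍ f = (X₁f,…,Xₙf,Y₁f,…,Yₙf)` (pointwise derivatives along the
horizontal left-invariant fields). -/
def gradH (f : Hpt n → ℝ) (p : Hpt n) : Fin (2*n) → ℝ :=
  fun j => lineDeriv ℝ f p (frameVec (hIdx j) p)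

/-- `f` is of class `C¹_ℍ` on `U`: it is continuous and its horizontal derivatives exist and
are (represented by) continuous functions on `U`. -/
structure IsC1H (U : Set (Hpt n)) (f : Hpt n → ℝ) : Prop where
  contOn : ContinuousOn f U
  ldiff : ∀ p ∈ U, ∀ j : Fin (2*n), LineDifferentiableAt ℝ f p (frameVec (hIdx j) p)
  contGrad : ∀ j : Fin (2*n), ContinuousOn (fun p => gradH f p j) U

/-- Horizontal gradient as a frame-coefficient vector in `ℝ^{2n+1}` (with zero `T`-component). -/
def gradF (f : Hpt n → ℝ) (q : Hpt n) : Fin (2*n+1) → ℝ :=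
  fun j => if h : (j:ℕ) < 2*n then gradH f q ⟨j, h⟩ else 0

/-- Horizontal derivative indexed by a natural number (0 outside the horizontal range). -/
def gradNat (f : Hpt n → ℝ) (q : Hpt n) (i : ℕ) : ℝ :=
  if h : i < 2*n then gradH f q ⟨i, h⟩ else 0

/-- The Pansu differential of a `C¹_ℍ` function: `d_ℍf_p(x,y,t) = Σⱼ(xⱼXⱼf(p) + yⱼYⱼf(p))`. -/
def pansuD (f : Hpt n → ℝ) (p : Hpt n) (q : Hpt n) : ℝ :=
  ∑ j : Fin n, (q.1 j * gradH f p ⟨(j:ℕ), by omega⟩ + q.2.1 j * gradH f p ⟨n + (j:ℕ), by omega⟩)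

/-- `S` is a `k`-codimensional `C¹_ℍ`-regular submanifold. -/
def IsC1HCodim (k : ℕ) (S : Set (Hpt n)) : Prop :=
  ∀ p ∈ S, ∃ U : Set (Hpt n), IsOpen U ∧ p ∈ U ∧
    ∃ f : Fin k → Hpt n → ℝ,
      (∀ i, IsC1H U (f i)) ∧
      (∀ q ∈ U, LinearIndependent ℝ (fun i => gradH (f i) q)) ∧
      S ∩ U = {q ∈ U | ∀ i, f i q = 0}

/-- `L : ℝ^k → ℍⁿ` is a group homomorphism. -/
def IsGroupHomH {k : ℕ} (L : (Fin k → ℝ) → Hpt n) : Prop :=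
  ∀ a b, L (a + b) = hmul (L a) (L b)

/-- Pansu differentiability of `f : ℝ^k → ℍⁿ` at `a`:
`δ_{1/λ}(f(a)⁻¹ ⬝ f(a + λb)) → L(b)` locally uniformly in `b`, with `L` a group homomorphism. -/
def HasPansuDerivAt {k : ℕ} (f : (Fin k → ℝ) → Hpt n) (L : (Fin k → ℝ) → Hpt n)
    (a : Fin k → ℝ) : Prop :=
  IsGroupHomH L ∧
    TendstoLocallyUniformly
      (fun (l : ℝ) (b : Fin k → ℝ) => hdil l⁻¹ (hmul (hinv (f a)) (f (a + l • b)))) L (𝓝[>] 0)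

/-- `S` is a `k`-dimensional (`k ≤ n`) `C¹_ℍ`-regular submanifold: locally the injective image
of an open set of `ℝ^k` under a continuously Pansu differentiable map with injective
Pansu differential. -/
def IsC1HDim (k : ℕ) (S : Set (Hpt n)) : Prop :=
  ∀ p ∈ S, ∃ U : Set (Hpt n), IsOpen U ∧ p ∈ U ∧
    ∃ V : Set (Fin k → ℝ), IsOpen V ∧
    ∃ (f : (Fin k → ℝ) → Hpt n) (Df : (Fin k → ℝ) → (Fin k → ℝ) → Hpt n),
      Set.InjOn f V ∧ Set.MapsTo f V U ∧
      (∀ a ∈ V, HasPansuDerivAt f (Df a) a ∧ Function.Injective (Df a)) ∧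
      (∀ b, ContinuousOn (fun a => Df a b) V) ∧
      S ∩ U = f '' V

/-- `C¹_ℍ`-regular submanifold of codimension `k`, for any `1 ≤ k ≤ 2n+1` (for `k ≥ n+1` this
means a low-dimensional submanifold of dimension `2n+1-k`). -/
def IsC1HSub (k : ℕ) (S : Set (Hpt n)) : Prop :=
  if k ≤ n then IsC1HCodim k S else IsC1HDim (2*n+1-k) S

/-! ## Distances and measures -/

/-- Open ball of a distance function. -/
def rawBall (d : Hpt n → Hpt n → ℝ) (p : Hpt n) (r : ℝ) : Set (Hpt n) := {q | d p q < r}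

/-- The gauge used to define the spherical Hausdorff measure of dimension `m` at scale `r`. -/
def sphGauge (d : Hpt n → Hpt n → ℝ) (m r : ℝ) (s : Set (Hpt n)) : ℝ≥0∞ :=
  ⨅ (c : Hpt n) (ρ : ℝ) (_ : 0 < ρ) (_ : ρ < r) (_ : s ⊆ rawBall d c ρ),
    ENNReal.ofReal ((2*ρ) ^ m)

/-- Spherical pre-measure at scale `r`. -/
def sphPre (d : Hpt n → Hpt n → ℝ) (m r : ℝ) : OuterMeasure (Hpt n) :=
  OuterMeasure.boundedBy (sphGauge d m r)

/-- The spherical Hausdorff outer measure `𝒮^m` associated with `d`. -/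
def sphOuter (d : Hpt n → Hpt n → ℝ) (m : ℝ) : OuterMeasure (Hpt n) :=
  ⨆ (r : ℝ) (_ : 0 < r), sphPre d m r

/-- A left invariant, homogeneous, rotationally invariant distance on `ℍⁿ`.
(The field `carat` records the — automatically true — fact that Borel sets are
Carathéodory measurable for the associated spherical measures.) -/
structure HomDist (n : ℕ) where
  d : Hpt n → Hpt n → ℝ
  symm : ∀ p q, d p q = d q p
  triangle : ∀ p q r, d p r ≤ d p q + d q r
  eq_iff : ∀ p q, d p q = 0 ↔ p = q
  leftInv : ∀ g p q, d (hmul g p) (hmul g q) = d p q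
  homog : ∀ l : ℝ, 0 < l → ∀ p q, d (hdil l p) (hdil l q) = l * d p q
  rotInv : ∀ p q : Hpt n,
    (∑ j, (p.1 j ^ 2 + p.2.1 j ^ 2)) = (∑ j, (q.1 j ^ 2 + q.2.1 j ^ 2)) →
    p.2.2 = q.2.2 → d 0 p = d 0 q
  carat : ∀ m : ℝ,
    (inferInstance : MeasurableSpace (Hpt n)) ≤ (sphOuter d m).caratheodory

/-- Open ball `U(p,r)` of a homogeneous distance. -/
def hball (D : HomDist n) (p : Hpt n) (r : ℝ) : Set (Hpt n) := rawBall D.d p r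

/-- The spherical Hausdorff measure `𝒮^m` of a homogeneous distance, as a measure. -/
def sphMeasure (D : HomDist n) (m : ℝ) : Measure (Hpt n) :=
  (sphOuter D.d m).toMeasure (D.carat m)

/-- `μ⌊A` is locally finite on `O`. -/
def LocFin (μ : Measure (Hpt n)) (A O : Set (Hpt n)) : Prop :=
  ∀ p ∈ O, ∃ U : Set (Hpt n), IsOpen U ∧ p ∈ U ∧ μ (A ∩ U) < ⊤

/-! ## Euclidean coordinates and Euclidean Hausdorff measures -/

/-- Realization of a coordinate vector `c ∈ ℝ^{2n+1}` as a point/tangent vector of `ℍⁿ`. -/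
def rE (c : Fin (2*n+1) → ℝ) : Hpt n :=
  (fun i => c ⟨(i:ℕ), by omega⟩, fun i => c ⟨n + (i:ℕ), by omega⟩, c ⟨2*n, by omega⟩)

/-- Coordinates of a point/tangent vector of `ℍⁿ` as a vector of `ℝ^{2n+1}`. -/
def toEc (q : Hpt n) : Fin (2*n+1) → ℝ := fun j =>
  if h : (j:ℕ) < n then q.1 ⟨j, h⟩
  else if h' : (j:ℕ) < 2*n then q.2.1 ⟨(j:ℕ) - n, by omega⟩
  else q.2.2

/-- Identification of `ℍⁿ` with the Euclidean space `ℝ^{2n+1}`. -/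
def ofE (q : EuclideanSpace ℝ (Fin (2*n+1))) : Hpt n := rE (fun j => q j)

/-- The `m`-dimensional Euclidean Hausdorff measure on `ℍⁿ ≡ ℝ^{2n+1}`. -/
def muE (n : ℕ) (m : ℝ) : Measure (Hpt n) :=
  Measure.map ofE (μH[m] : Measure (EuclideanSpace ℝ (Fin (2*n+1))))

/-! ## Multivectors -/

/-- Index sets for a basis of `Λ_k 𝔥`. -/
def IdxSet (n k : ℕ) := {s : Finset (Fin (2*n+1)) // s.card = k}

instance (n k : ℕ) : Fintype (IdxSet n k) := by unfold IdxSet; infer_instance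

/-- The increasing enumeration of an index set. -/
def idxTuple {k : ℕ} (s : IdxSet n k) (i : Fin k) : Fin (2*n+1) :=
  ((s.1.orderIsoOfFin s.2) i).1

/-- `k`-vectors, as coefficients with respect to the canonical basis of `Λ_k ℝ^{2n+1}`. -/
abbrev MVec (n k : ℕ) := IdxSet n k → ℝ

/-- The simple `k`-vector `v₁ ∧ ⋯ ∧ v_k`. -/
def simpleWedge {k : ℕ} (v : Fin k → (Fin (2*n+1) → ℝ)) : MVec n k :=
  fun s => Matrix.det (Matrix.of fun i j => v i (idxTuple s j))

/-- Degree cast for multivectors. -/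
def mvCast {a b : ℕ} (h : a = b) (t : MVec n a) : MVec n b :=
  fun s => t ⟨s.1, by rw [h]; exact s.2⟩

/-- Euclidean scalar product of coefficient vectors. -/
def dotC (a b : Fin (2*n+1) → ℝ) : ℝ := ∑ j, a j * b j

/-- Pairing `⟨t | η⟩` at `p` of a `k`-vector (in the left invariant frame `X₁,…,Yₙ,T`)
with a `k`-form. -/
def pairF {k : ℕ} (t : MVec n k) (p : Hpt n) (η : (Fin k → Hpt n) → ℝ) : ℝ :=
  ∑ s, t s * η (fun i => frameVec (idxTuple s i) p)

/-- The `j`-th coordinate basis vector of `ℝ^{2n+1}`. -/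
def coordC (j : Fin (2*n+1)) : Fin (2*n+1) → ℝ := fun j' => if j' = j then 1 else 0

/-- Pairing `⟨t | η⟩` of a `k`-vector (in the coordinate basis `∂x,∂y,∂t`) with a `k`-form. -/
def pairE {k : ℕ} (t : MVec n k) (η : (Fin k → Hpt n) → ℝ) : ℝ :=
  ∑ s, t s * η (fun i => rE (coordC (idxTuple s i)))

/-- Realization of a frame-coefficient vector as a tangent vector at `p`. -/
def rF (c : Fin (2*n+1) → ℝ) (p : Hpt n) : Hpt n := ∑ j, c j • frameVec j p

/-! ## Covectors and Heisenberg forms -/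

/-- `k`-covectors on `ℍⁿ`. -/
abbrev Cov (n k : ℕ) := AlternatingMap ℝ (Hpt n) ℝ (Fin k)

/-- Wedge product of covectors. -/
def cwedge {k l : ℕ} (α : Cov n k) (β : Cov n l) : Cov n (k + l) :=
  AlternatingMap.domDomCongr finSumFinEquiv
    ((TensorProduct.lid ℝ ℝ).toLinearMap.compAlternatingMap (AlternatingMap.domCoprod α β))

/-- Degree cast for covectors. -/
def covCast {a b : ℕ} (h : a = b) (α : Cov n a) : Cov n b :=
  AlternatingMap.domDomCongr (finCongr h) α

def projX (j : Fin n) : Hpt n →ₗ[ℝ] ℝ := (LinearMap.proj j).comp (LinearMap.fst ℝ _ _)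

def projY (j : Fin n) : Hpt n →ₗ[ℝ] ℝ :=
  (LinearMap.proj j).comp ((LinearMap.fst ℝ _ _).comp (LinearMap.snd ℝ _ _))

def projT : Hpt n →ₗ[ℝ] ℝ := (LinearMap.snd ℝ _ _).comp (LinearMap.snd ℝ _ _)

/-- The contact form `θ = dt + ½Σⱼ(yⱼdxⱼ − xⱼdyⱼ)` at `p`, as a linear functional. -/
def thetaLin (p : Hpt n) : Hpt n →ₗ[ℝ] ℝ :=
  projT + (2:ℝ)⁻¹ • (∑ j : Fin n, (p.2.1 j • projX j - p.1 j • projY j))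

/-- A linear functional as a `1`-covector. -/
def cov1 (L : Hpt n →ₗ[ℝ] ℝ) : Cov n 1 :=
  AlternatingMap.ofSubsingleton ℝ (Hpt n) ℝ (0 : Fin 1) L

/-- `θ` as a `1`-covector. -/
def thetaC (p : Hpt n) : Cov n 1 := cov1 (thetaLin p)

/-- `dθ = −Σⱼ dxⱼ∧dyⱼ` as a (constant) `2`-covector. -/
def dthetaC : Cov n 2 := -∑ j : Fin n, cwedge (cov1 (projX j)) (cov1 (projY j))

/-- Membership in the Rumin ideal `ℐ^k = {λ∧θ + μ∧dθ}` at the point `p`. -/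
def memI {k : ℕ} (p : Hpt n) (ω : Cov n k) : Prop :=
  ∃ (a : Cov n (k-1)) (ω₂ : Cov n k) (h1 : (k-1)+1 = k),
    ω = covCast h1 (cwedge a (thetaC p)) + ω₂ ∧
    (ω₂ = 0 ∨ ∃ (b : Cov n (k-2)) (h2 : (k-2)+2 = k), ω₂ = covCast h2 (cwedge b dthetaC))

/-- Membership in `𝒥^k = {λ : λ∧θ = λ∧dθ = 0}` at the point `p`. -/
def memJ {k : ℕ} (p : Hpt n) (ω : Cov n k) : Prop :=
  cwedge ω (thetaC p) = 0 ∧ cwedge ω dthetaC = 0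

/-- A compactly supported smooth Heisenberg `k`-form on `O` (for `k ≤ n` the values are
representatives of classes modulo `ℐ^k`; for `k ≥ n+1` they lie in `𝒥^k`). -/
structure IsHFormD (k : ℕ) (O : Set (Hpt n)) (ω : Hpt n → Cov n k) : Prop where
  smooth : ∀ v : Fin k → Hpt n, ContDiff ℝ (⊤ : ℕ∞) fun p => ω p v
  cptSupp : ∃ K : Set (Hpt n), IsCompact K ∧ K ⊆ O ∧ ∀ p ∉ K, ω p = 0
  vert : n + 1 ≤ k → ∀ p, memJ p (ω p)

/-- Exterior derivative (as a raw multilinear expression):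
`dω_p(v₀,…,v_k) = Σᵢ (−1)ⁱ ∂_{vᵢ}(q ↦ ω_q(v₀,…,v̂ᵢ,…,v_k))(p)`. -/
def extD {k : ℕ} (ω : Hpt n → Cov n k) (p : Hpt n) (v : Fin (k+1) → Hpt n) : ℝ :=
  ∑ i : Fin (k+1), (-1 : ℝ)^(i:ℕ) * fderiv ℝ (fun q => ω q (v ∘ i.succAbove)) p (v i)

/-- `η` is the Rumin operator `D` applied to `ω` (only meaningful in degree `k = n`):
`Dω = d(ω − θ∧β)` where `β = L⁻¹((dω)_{𝔥₁})`, i.e. `β` is horizontal and `β∧dθ` agrees with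
`dω` on horizontal vectors. -/
def IsRuminD {k : ℕ} (ω : Hpt n → Cov n k) (η : Hpt n → (Fin (k+1) → Hpt n) → ℝ) : Prop :=
  ∃ (β : Hpt n → Cov n (k-1)) (h1 : 1 + (k-1) = k) (h2 : (k-1)+2 = k+1),
    (∀ v, ContDiff ℝ (⊤ : ℕ∞) fun p => β p v) ∧
    (∀ (p : Hpt n) (v : Fin (k-1) → Hpt n) (i : Fin (k-1)),
      v i = ((0:Fin n → ℝ), (0:Fin n → ℝ), (1:ℝ)) → β p v = 0) ∧
    (∀ (p : Hpt n) (v : Fin (k+1) → Hpt n), (∀ i, thetaLin p (v i) = 0) →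
      extD ω p v = covCast h2 (cwedge (β p) dthetaC) v) ∧
    η = extD (fun p => ω p - covCast h1 (cwedge (thetaC p) (β p)))

/-- The Rumin differential `d_c`: the exterior derivative in degree `k ≠ n`, the second order
operator `D` in the critical degree `k = n`. -/
def IsDc {k : ℕ} (ω : Hpt n → Cov n k) (η : Hpt n → (Fin (k+1) → Hpt n) → ℝ) : Prop :=
  if k = n then IsRuminD ω η else η = extD ω

/-- Degree cast for raw forms. -/
def rawCast {a b : ℕ} (h : a = b) (η : (Fin a → Hpt n) → ℝ) : (Fin b → Hpt n) → ℝ :=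
  fun v => η (fun i => v (Fin.cast h i))

/-! ## Orientations and currents -/

/-- `t` is a unit tangent `m`-vector of the `k`-codimensional `C¹_ℍ` submanifold `S` at `p`,
i.e. `t = ±*n^ℍ_S(p)`: `t` is the wedge of an orthonormal basis of `ker d_ℍf_p`
(in the left invariant frame). -/
def IsHTangentVecAt (k m : ℕ) (S : Set (Hpt n)) (p : Hpt n) (t : MVec n m) : Prop :=
  ∃ (U : Set (Hpt n)) (f : Fin k → Hpt n → ℝ), IsOpen U ∧ p ∈ U ∧
    (∀ i, IsC1H U (f i)) ∧
    (∀ q ∈ U, LinearIndependent ℝ (fun i => gradH (f i) q)) ∧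
    S ∩ U = {q ∈ U | ∀ i, f i q = 0} ∧
    ∃ v : Fin m → (Fin (2*n+1) → ℝ),
      (∀ i j, dotC (v i) (v j) = if i = j then 1 else 0) ∧
      (∀ i l, dotC (v i) (gradF (f l) p) = 0) ∧
      t = simpleWedge v

/-- An orientation of a `k`-codimensional `C¹_ℍ` submanifold: a continuous global choice of
the unit tangent `(2n+1−k)`-vector `t^ℍ_S` (here of formal degree `m`). -/
def IsHOrient (k m : ℕ) (S : Set (Hpt n)) (t : Hpt n → MVec n m) : Prop :=
  ContinuousOn t S ∧ ∀ p ∈ S, IsHTangentVecAt k m S p (t p)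

/-- Classical Euclidean unit tangent `m`-vector at a point of an `m`-dimensional submanifold
(coefficients in the coordinate basis). -/
def IsEuclTangentVecAt (m : ℕ) (S : Set (Hpt n)) (p : Hpt n) (t : MVec n m) : Prop :=
  ∃ v : Fin m → (Fin (2*n+1) → ℝ),
    (∀ i j, dotC (v i) (v j) = if i = j then 1 else 0) ∧
    (∀ i, rE (v i) ∈ tangentConeAt ℝ S p) ∧ t = simpleWedge v

/-- Classical (Euclidean) orientation of a low-dimensional submanifold. -/
def IsEuclOrient (m : ℕ) (S : Set (Hpt n)) (t : Hpt n → MVec n m) : Prop :=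
  ContinuousOn t S ∧ ∀ p ∈ S, IsEuclTangentVecAt m S p (t p)

/-- The standard vertical subgroup `𝕎` of codimension `k`. -/
def Wstd (n k : ℕ) : Set (Hpt n) := {p | ∀ i : Fin n, (i:ℕ) < k → p.1 i = 0}

/-- Embedding realizing `𝕎` as a Euclidean space. -/
def wEmbed (n k : ℕ) (a : ({i : Fin n // k ≤ (i:ℕ)} → ℝ) × (Fin n → ℝ) × ℝ) : Hpt n :=
  (fun i => if h : k ≤ (i:ℕ) then a.1 ⟨i, h⟩ else 0, a.2.1, a.2.2)

/-- Lebesgue measure `ℒ^{2n+1−k}` on the vertical subgroup `𝕎`. -/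
def wLeb (n k : ℕ) : Measure (Hpt n) := Measure.map (wEmbed n k) volume

/-- The geometric constant
`C_{n,k} = (sup{ℒ^{2n+1−k}(𝕎 ∩ U(p,1)) : p ∈ U(0,1)})⁻¹`. -/
def CnkC (D : HomDist n) (k : ℕ) : ℝ :=
  (sSup {v : ℝ | ∃ p ∈ hball D 0 1, v = (wLeb n k (Wstd n k ∩ hball D p 1)).toReal})⁻¹

/-- The Heisenberg current `⟦S⟧` of an oriented `k`-codimensional (`k ≤ n`) submanifold:
`⟦S⟧(ω) = (1/C_{n,k}) ∫_S ⟨t^ℍ_S | ω⟩ d𝒮^{Q−k}`. -/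
def currF (D : HomDist n) (k : ℕ) (S : Set (Hpt n)) (t : Hpt n → MVec n (2*n+1-k))
    (η : Hpt n → (Fin (2*n+1-k) → Hpt n) → ℝ) : ℝ :=
  (CnkC D k)⁻¹ * ∫ p in S, pairF (t p) p (η p) ∂(sphMeasure D ((2*n+2 : ℝ) - (k : ℝ)))

/-- The current of an oriented low-dimensional (`m ≤ n`) submanifold: the classical integral
`⟦S⟧(ω) = ∫_S ⟨τ_S | ω⟩ d𝓗^m_E`. -/
def currE {n : ℕ} (m : ℕ) (S : Set (Hpt n)) (t : Hpt n → MVec n m)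
    (η : Hpt n → (Fin m → Hpt n) → ℝ) : ℝ :=
  ∫ p in S, pairE (t p) (η p) ∂(muE n (m : ℝ))

/-- The Heisenberg current of an oriented `m`-dimensional submanifold (any `m`). -/
def hCurr (D : HomDist n) (m : ℕ) (S : Set (Hpt n)) (t : Hpt n → MVec n m)
    (η : Hpt n → (Fin m → Hpt n) → ℝ) : ℝ :=
  if m ≤ n then currE m S t η
  else if h2 : m ≤ 2*n+1 then
    currF D (2*n+1-m) S (fun p => mvCast (by omega) (t p)) (fun p => rawCast (by omega) (η p))
  else 0

/-- Orientation of an `m`-dimensional submanifold (any `m`): Euclidean in low dimension,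
the continuous unit tangent field `t^ℍ_S` in low codimension. -/
def IsOrientS (m : ℕ) (S : Set (Hpt n)) (t : Hpt n → MVec n m) : Prop :=
  if m ≤ n then IsEuclOrient m S t else IsHOrient (2*n+1-m) m S t

/-! ## Submanifolds with boundary -/

/-- The boundary `∂S = S̄ ∖ S`. -/
def bdry (S : Set (Hpt n)) : Set (Hpt n) := closure S \ S

/-- `S` is a `k`-codimensional `C¹_ℍ`-regular submanifold with boundary in `O`. -/
def IsC1HSubWithBdry (D : HomDist n) (k : ℕ) (O : Set (Hpt n)) (S : Set (Hpt n)) : Prop :=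
  (O ∩ S).Nonempty ∧ IsC1HSub k (O ∩ S) ∧
  (O ∩ bdry S).Nonempty ∧ IsC1HSub (k+1) (O ∩ bdry S) ∧
  ∀ p ∈ O ∩ bdry S, ∃ U : Set (Hpt n), IsOpen U ∧ p ∈ U ∧
    ∃ S' : Set (Hpt n), S' ⊆ U ∧ IsC1HSub k S' ∧ U ∩ closure S ⊆ S' ∧
      ∀ r : ℝ, 0 < r → (hball D p r ∩ (S' \ closure S)).Nonempty

/-- A family `f₁,…,f_{k+1}` of local defining functions at a boundary point `p`, as in the
characterization of `k`-codimensional submanifolds with boundary: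
`U ∩ S = {f₁ = ⋯ = f_k = 0, f_{k+1} > 0}` and `f_{k+1}(p) = 0`. -/
def IsBdryFrame (k : ℕ) (S : Set (Hpt n)) (p : Hpt n) (U : Set (Hpt n))
    (f : Fin (k+1) → Hpt n → ℝ) : Prop :=
  IsOpen U ∧ p ∈ U ∧ (∀ i, IsC1H U (f i)) ∧
  (∀ q ∈ U, LinearIndependent ℝ (fun i => gradH (f i) q)) ∧
  U ∩ S = {q ∈ U | (∀ i : Fin k, f i.castSucc q = 0) ∧ 0 < f (Fin.last k) q} ∧
  f (Fin.last k) p = 0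

/-! ## Smooth and Euclidean submanifolds -/

/-- `S` is a smooth (Euclidean `C^∞`) submanifold of codimension `k`. -/
def IsSmoothCodim (k : ℕ) (S : Set (Hpt n)) : Prop :=
  ∀ p ∈ S, ∃ U : Set (Hpt n), IsOpen U ∧ p ∈ U ∧ ∃ f : Fin k → Hpt n → ℝ,
    (∀ i, ContDiff ℝ (⊤ : ℕ∞) (f i)) ∧
    (∀ q ∈ U, LinearIndependent ℝ (fun i => fderiv ℝ (f i) q)) ∧
    S ∩ U = {q ∈ U | ∀ i, f i q = 0}

/-- `S` is a Euclidean `C¹` submanifold of codimension `k`. -/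
def IsC1ECodim (k : ℕ) (S : Set (Hpt n)) : Prop :=
  ∀ p ∈ S, ∃ U : Set (Hpt n), IsOpen U ∧ p ∈ U ∧ ∃ f : Fin k → Hpt n → ℝ,
    (∀ i, ContDiff ℝ 1 (f i)) ∧
    (∀ q ∈ U, LinearIndependent ℝ (fun i => fderiv ℝ (f i) q)) ∧
    S ∩ U = {q ∈ U | ∀ i, f i q = 0}

/-- `M` is a Euclidean `k`-dimensional `C¹` submanifold with boundary (`M` closed in its
charts; boundary charts are half-spaces). -/
def IsC1EuclSubWithBdryDim (k : ℕ) (M : Set (Hpt n)) : Prop :=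
  ∀ p ∈ M, ∃ (V : Set (Fin k → ℝ)) (φ : (Fin k → ℝ) → Hpt n) (U : Set (Hpt n)) (a : Fin k → ℝ)
      (i₀ : Fin k),
    IsOpen V ∧ IsOpen U ∧ p ∈ U ∧ a ∈ V ∧ φ a = p ∧
    ContDiffOn ℝ 1 φ V ∧ Set.InjOn φ V ∧
    (∀ b ∈ V, Function.Injective (fderivWithin ℝ φ V b)) ∧
    (M ∩ U = φ '' (V ∩ {x | 0 ≤ x i₀}) ∨ M ∩ U = φ '' V)

/-! ## Isometries -/

/-- A rotation of the horizontal layer: a linear group automorphism commuting with dilations,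
preserving the vertical coordinate and the horizontal Euclidean norm. -/
def IsRotation (R : Hpt n → Hpt n) : Prop :=
  IsLinearMap ℝ R ∧ (∀ p q, R (hmul p q) = hmul (R p) (R q)) ∧
  (∀ l p, R (hdil l p) = hdil l (R p)) ∧
  (∀ p, (R p).2.2 = p.2.2) ∧
  (∀ p, (∑ j, ((R p).1 j ^ 2 + (R p).2.1 j ^ 2)) = ∑ j, (p.1 j ^ 2 + p.2.1 j ^ 2))

/-- An isometry of `ℍⁿ`: the composition of a left translation and a rotation. -/
def IsHIsom (φ : Hpt n → Hpt n) : Prop :=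
  ∃ (g : Hpt n) (R : Hpt n → Hpt n), IsRotation R ∧ φ = fun p => hmul g (R p)

/-! ## Tangent cones and blow-ups -/

/-- The tangent cone `T^ℍ_0 E` at the origin. -/
def tangentConeH (E : Set (Hpt n)) : Set (Hpt n) :=
  {x | ∃ (xh : ℕ → Hpt n) (rh : ℕ → ℝ), (∀ h, xh h ∈ E) ∧ Tendsto rh atTop atTop ∧
        Tendsto (fun h => hdil (rh h) (xh h)) atTop (𝓝 x)}

/-- The tangent cone `T^ℍ_p E = T^ℍ_0(p⁻¹ ⬝ E)`. -/
def tangentConeHAt (E : Set (Hpt n)) (p : Hpt n) : Set (Hpt n) :=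
  tangentConeH ((fun q => hmul (hinv p) q) '' E)

/-- Local Hausdorff convergence of the sets `F l` to `E` as `l → 0⁺`, with respect to the
homogeneous distance `D`. -/
def LocHausConv (D : HomDist n) (F : ℝ → Set (Hpt n)) (E : Set (Hpt n)) : Prop :=
  ∀ (c : Hpt n) (R ε : ℝ), 0 < R → 0 < ε → ∃ l0 : ℝ, 0 < l0 ∧ ∀ l : ℝ, 0 < l → l < l0 →
    (∀ x ∈ F l ∩ {q | D.d c q ≤ R}, ∃ e ∈ E, D.d x e < ε) ∧
    (∀ x ∈ E ∩ {q | D.d c q ≤ R}, ∃ y ∈ F l, D.d x y < ε)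

/-! ## Induced orientation on the boundary -/

/-- `tB` is the value at `p ∈ ∂S` of the orientation induced on `∂S` by the orientation `tS`
of the `m`-dimensional submanifold with boundary `S`. -/
def InducedBdryOrientAt (D : HomDist n) (m : ℕ) (S : Set (Hpt n)) (p : Hpt n)
    (tS : MVec n m) (tB : MVec n (m-1)) : Prop :=
  if m ≤ n then
    -- low dimension: classical Euclidean induced orientation via the outward normal
    ∃ (νc : Fin (2*n+1) → ℝ) (w : Fin (m-1) → (Fin (2*n+1) → ℝ)) (h : (m-1)+1 = m),
      (∀ i j : Fin ((m-1)+1), dotC (Matrix.vecCons νc w i) (Matrix.vecCons νc w j) = if i = j then 1 else 0) ∧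
      rE νc ∉ tangentConeAt ℝ (closure S) p ∧
      -(rE νc) ∈ tangentConeAt ℝ (closure S) p ∧
      (∀ i, rE (w i) ∈ tangentConeAt ℝ (bdry S) p) ∧
      tB = simpleWedge w ∧ tS = mvCast h (simpleWedge (Matrix.vecCons νc w))
  else if m = n+1 then
    -- critical codimension: `±T ∧ τ_{∂S} = t^ℍ_S` according to whether `S` lies below/above ∂S
    ∃ (U : Set (Hpt n)) (f : Fin n → Hpt n → ℝ), IsOpen U ∧ p ∈ U ∧
      (∀ i, IsC1H U (f i)) ∧ (∀ q ∈ U, LinearIndependent ℝ (fun i => gradH (f i) q)) ∧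
      U ∩ closure S ⊆ {q ∈ U | ∀ i, f i q = 0} ∧
      (∀ r : ℝ, 0 < r →
        (hball D p r ∩ ({q ∈ U | ∀ i, f i q = 0} \ closure S)).Nonempty) ∧
      ∃ (ε : ℝ) (w : Fin (m-1) → (Fin (2*n+1) → ℝ)) (h : (m-1)+1 = m),
        (ε = 1 ∨ ε = -1) ∧
        (∀ i j, dotC (w i) (w j) = if i = j then 1 else 0) ∧
        (∀ i, w i ⟨2*n, by omega⟩ = 0) ∧
        (∀ i, rF (w i) p ∈ tangentConeAt ℝ (bdry S) p) ∧
        -- `ε = −1` iff `S` lies above its boundary around `p`: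
        -- the blow-up of `S` at `p` is the corresponding open half of `T^ℍ_pS`
        LocHausConv D (fun l => (fun q => hdil l⁻¹ (hmul (hinv p) q)) '' S)
          ({v | ∀ i, pansuD (f i) p v = 0} ∩ {q | 0 < (-ε) * q.2.2}) ∧
        tB = simpleWedge (fun i => toEc (rF (w i) p)) ∧
        tS = mvCast h (simpleWedge (Matrix.vecCons (fun j => if (j:ℕ) = 2*n then ε else 0) w))
  else
    -- non-critical low codimension: `ν_{∂S} ∧ t^ℍ_{∂S} = t^ℍ_S` with `ν` the outward normal
    ∃ (U : Set (Hpt n)) (f : Fin (2*n+1-m+1) → Hpt n → ℝ),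
      IsBdryFrame (2*n+1-m) S p U f ∧
      ∃ (νc : Fin (2*n+1) → ℝ) (w : Fin (m-1) → (Fin (2*n+1) → ℝ)) (h : (m-1)+1 = m),
        (∀ i j : Fin ((m-1)+1), dotC (Matrix.vecCons νc w i) (Matrix.vecCons νc w j) = if i = j then 1 else 0) ∧
        (∀ i : Fin (2*n+1-m), pansuD (f i.castSucc) p (rE νc) = 0) ∧
        pansuD (f (Fin.last (2*n+1-m))) p (rE νc) < 0 ∧
        (∀ i, ∀ l : Fin (2*n+1-m+1), pansuD (f l) p (rE (w i)) = 0) ∧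
        tB = simpleWedge w ∧ tS = mvCast h (simpleWedge (Matrix.vecCons νc w))

/-! ## Miscellaneous -/

/-- The projection `π_p(q) = Σⱼ xⱼXⱼ(p) + Σⱼ yⱼYⱼ(p) ∈ H_pℍⁿ`. -/
def piProj (p q : Hpt n) : Hpt n :=
  (∑ j : Fin n, q.1 j • frameVec ⟨(j:ℕ), by omega⟩ p) +
  (∑ j : Fin n, q.2.1 j • frameVec ⟨n + (j:ℕ), by omega⟩ p)

/-- The norm `|·|_p` on the horizontal fibre `H_pℍⁿ` making `X₁(p),…,Yₙ(p)` orthonormal. -/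
def hnormAt (_p : Hpt n) (v : Hpt n) : ℝ :=
  Real.sqrt (∑ j, ((v.1 j) ^ 2 + (v.2.1 j) ^ 2))

/-- The left-invariant scalar product making `X₁,…,Yₙ,T` orthonormal. -/
def dotH (v w : Hpt n) : ℝ :=
  (∑ j, v.1 j * w.1 j) + (∑ j, v.2.1 j * w.2.1 j) + v.2.2 * w.2.2
/-! ## Part 1: strict Pansu differentiability along horizontal elements -/

/-- Horizontal vectors. -/
abbrev HE (n : ℕ) : Type := (Fin n → ℝ) × (Fin n → ℝ)

/-- The group element of a horizontal vector. -/
def hz (v : HE n) : Hpt n := (v.1, v.2, 0)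

/-- `f(q·φ(v)) - f(q) - ℓ(v) = o(v)` as `(q,v) → (p,0)`. -/
def StrictP (f : Hpt n → ℝ) (p : Hpt n) (φ : HE n → Hpt n) (l : HE n → ℝ) : Prop :=
  (fun z : Hpt n × HE n => f (hmul z.1 (φ z.2)) - f z.1 - l z.2)
    =o[𝓝 ((p, 0) : Hpt n × HE n)] fun z => z.2

lemma continuous_hmul : Continuous fun z : Hpt n × Hpt n => hmul z.1 z.2 := by
  unfold hmul
  fun_prop

lemma hmul_assoc' (p q r : Hpt n) : hmul (hmul p q) r = hmul p (hmul q r) := by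
  unfold hmul
  refine Prod.ext (by simp [add_assoc]) (Prod.ext (by simp [add_assoc]) ?_)
  simp only [Pi.add_apply, add_mul, mul_add, Finset.sum_add_distrib]
  ring

lemma hmul_zero' (p : Hpt n) : hmul p 0 = p := by
  unfold hmul
  refine Prod.ext (by simp) (Prod.ext (by simp) ?_)
  simp

lemma zero_hmul' (p : Hpt n) : hmul 0 p = p := by
  unfold hmul
  refine Prod.ext (by simp) (Prod.ext (by simp) ?_)
  simp

lemma StrictP.comp {f : Hpt n → ℝ} {p : Hpt n} {φ ψ : HE n → Hpt n} {l m : HE n → ℝ}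
    (h1 : StrictP f p φ l) (h2 : StrictP f p ψ m) (hφ : Continuous φ) (hφ0 : φ 0 = 0) :
    StrictP f p (fun v => hmul (φ v) (ψ v)) (fun v => l v + m v) := by
  unfold StrictP at *
  have ht : Tendsto (fun z : Hpt n × HE n => (hmul z.1 (φ z.2), z.2))
      (𝓝 ((p, 0) : Hpt n × HE n)) (𝓝 ((p, 0) : Hpt n × HE n)) := by
    have hc : Continuous (fun z : Hpt n × HE n => (hmul z.1 (φ z.2), z.2)) :=
      (continuous_hmul.comp (continuous_fst.prodMk (hφ.comp continuous_snd))).prodMk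
        continuous_snd
    have := hc.tendsto (p, 0)
    simpa [hφ0, hmul_zero'] using this
  have h3 := h2.comp_tendsto ht
  refine (h1.add h3).congr_left ?_
  intro z
  simp only [Function.comp, hmul_assoc']
  ring

/-- The horizontal unit vectors. -/
def eX (j : Fin n) : HE n := (Pi.single j 1, 0)
def eY (j : Fin n) : HE n := (0, Pi.single j 1)

lemma frame_X (j : Fin n) (q : Hpt n) :
    frameVec (hIdx (⟨(j:ℕ), by omega⟩ : Fin (2*n))) q = (Pi.single j 1, 0, -(q.2.1 j) / 2) := by
  simp [frameVec, hIdx]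

lemma frame_Y (j : Fin n) (q : Hpt n) :
    frameVec (hIdx (⟨n + (j:ℕ), by omega⟩ : Fin (2*n))) q = (0, Pi.single j 1, q.1 j / 2) := by
  have : n + (j:ℕ) < 2 * n := by omega
  simp [frameVec, hIdx, this]

lemma line_X (j : Fin n) (q : Hpt n) (s : ℝ) :
    q + s • frameVec (hIdx (⟨(j:ℕ), by omega⟩ : Fin (2*n))) q = hmul q (hz (s • eX j)) := by
  rw [frame_X]
  unfold hmul hz eX
  refine Prod.ext (by simp) (Prod.ext (by simp) ?_)
  simp [Pi.single_apply]
  ring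

lemma line_Y (j : Fin n) (q : Hpt n) (s : ℝ) :
    q + s • frameVec (hIdx (⟨n + (j:ℕ), by omega⟩ : Fin (2*n))) q = hmul q (hz (s • eY j)) := by
  rw [frame_Y]
  unfold hmul hz eY
  refine Prod.ext (by simp) (Prod.ext (by simp) ?_)
  simp [Pi.single_apply]
  ring

lemma frame_const (j : Fin (2*n)) (q : Hpt n) (s : ℝ) :
    frameVec (hIdx j) (q + s • frameVec (hIdx j) q) = frameVec (hIdx j) q := by
  by_cases hj : (j:ℕ) < n
  · have : j = (⟨((⟨j, hj⟩ : Fin n):ℕ), by omega⟩ : Fin (2*n)) := rfl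
    rw [this, frame_X, frame_X]
    simp
  · have : j = (⟨n + ((⟨(j:ℕ) - n, by omega⟩ : Fin n):ℕ), by omega⟩ : Fin (2*n)) := by
      apply Fin.ext; simp; omega
    rw [this, frame_Y, frame_Y]
    simp

lemma continuous_frame (j : Fin (2*n)) : Continuous fun q : Hpt n => frameVec (hIdx j) q := by
  by_cases hj : (j:ℕ) < n
  · have : j = (⟨((⟨j, hj⟩ : Fin n):ℕ), by omega⟩ : Fin (2*n)) := rfl
    rw [this, funext (frame_X (⟨j, hj⟩ : Fin n))]
    fun_prop
  · have : j = (⟨n + ((⟨(j:ℕ) - n, by omega⟩ : Fin n):ℕ), by omega⟩ : Fin (2*n)) := by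
      apply Fin.ext; simp; omega
    rw [this, funext (frame_Y (⟨(j:ℕ) - n, by omega⟩ : Fin n))]
    fun_prop

/-- Mean value estimate along one frame direction. -/
lemma strict_one {U : Set (Hpt n)} (hU : IsOpen U) {f : Hpt n → ℝ} (hf : IsC1H U f)
    {p : Hpt n} (hp : p ∈ U) (j : Fin (2*n)) :
    (fun z : Hpt n × ℝ => f (z.1 + z.2 • frameVec (hIdx j) z.1) - f z.1 - z.2 * gradH f p j)
      =o[𝓝 ((p, 0) : Hpt n × ℝ)] fun z => z.2 := by
  rw [Asymptotics.isLittleO_iff]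
  intro ε hε
  have hc : Continuous (fun z : Hpt n × ℝ => z.1 + z.2 • frameVec (hIdx j) z.1) := by
    have := continuous_frame j
    fun_prop
  have ht : Tendsto (fun z : Hpt n × ℝ => z.1 + z.2 • frameVec (hIdx j) z.1)
      (𝓝 ((p, 0) : Hpt n × ℝ)) (𝓝 p) := by
    simpa using hc.tendsto (p, 0)
  have hg : ContinuousAt (fun q => gradH f q j) p := (hf.contGrad j).continuousAt (hU.mem_nhds hp)
  have h1 : ∀ᶠ q in 𝓝 p, q ∈ U ∧ ‖gradH f q j - gradH f p j‖ ≤ ε := by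
    have hev : ∀ᶠ q in 𝓝 p, q ∈ U := hU.mem_nhds hp
    refine hev.and ?_
    have := (Metric.tendsto_nhds.1 hg) ε hε
    filter_upwards [this] with q hq
    rw [dist_eq_norm] at hq
    exact hq.le
  have h2 := ht.eventually h1
  rw [Metric.eventually_nhds_iff_ball] at h2
  obtain ⟨r, hr, h2⟩ := h2
  rw [Metric.eventually_nhds_iff_ball]
  refine ⟨r, hr, ?_⟩
  rintro ⟨q, s⟩ hqs
  have hqs' : dist q p < r ∧ |s| < r := by
    rw [Metric.mem_ball, Prod.dist_eq, max_lt_iff] at hqs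
    exact ⟨hqs.1, by simpa using hqs.2⟩
  have key : ∀ u ∈ uIcc 0 s, HasDerivWithinAt
      (fun u => f (q + u • frameVec (hIdx j) q) - u * gradH f p j)
      (gradH f (q + u • frameVec (hIdx j) q) j - gradH f p j) (uIcc 0 s) u ∧
      ‖gradH f (q + u • frameVec (hIdx j) q) j - gradH f p j‖ ≤ ε := by
    intro u hu
    have hu' : |u| < r := by
      rcases le_total 0 s with h | h
      · rw [uIcc_of_le h] at hu
        rw [abs_of_nonneg hu.1]
        exact lt_of_le_of_lt (hu.2.trans (le_abs_self s)) hqs'.2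
      · rw [uIcc_of_ge h] at hu
        rw [abs_of_nonpos hu.2]
        exact lt_of_le_of_lt (by rw [abs_of_nonpos h]; linarith [hu.1]) hqs'.2
    have hm := h2 (q, u) (by
      rw [Metric.mem_ball, Prod.dist_eq, max_lt_iff]
      exact ⟨hqs'.1, by simpa using hu'⟩)
    refine ⟨?_, hm.2⟩
    have hd := (hf.ldiff _ hm.1 j).hasLineDerivAt
    rw [frame_const] at hd
    have hgr : gradH f (q + u • frameVec (hIdx j) q) j =
        lineDeriv ℝ f (q + u • frameVec (hIdx j) q) (frameVec (hIdx j) q) := by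
      simp only [gradH]
      rw [frame_const]
    rw [hgr]
    unfold HasLineDerivAt at hd
    have hd2 : HasDerivAt (fun u => f (q + u • frameVec (hIdx j) q))
        (lineDeriv ℝ f (q + u • frameVec (hIdx j) q) (frameVec (hIdx j) q)) u := by
      have h0 : HasDerivAt (fun t : ℝ => f (q + u • frameVec (hIdx j) q + t • frameVec (hIdx j) q))
        (lineDeriv ℝ f (q + u • frameVec (hIdx j) q) (frameVec (hIdx j) q)) (u - u) := by
        rw [sub_self]; exact hd
      have h3 := HasDerivAt.comp_sub_const u u h0
      refine h3.congr_of_eventuallyEq (Eventually.of_forall fun t => ?_)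
      simp only
      congr 1
      rw [add_assoc, ← add_smul]
      congr 2
      ring
    have h4 := hd2.sub ((hasDerivAt_id u).mul_const (gradH f p j))
    simp only [one_mul] at h4
    exact h4.hasDerivWithinAt
  have := (convex_uIcc 0 s).norm_image_sub_le_of_norm_hasDerivWithin_le
    (fun u hu => (key u hu).1) (fun u hu => (key u hu).2) left_mem_uIcc right_mem_uIcc
  simp only [zero_smul, add_zero, zero_mul, sub_zero] at this
  refine le_trans (le_of_eq ?_) this
  congr 1
  ring

lemma strict_X {U : Set (Hpt n)} (hU : IsOpen U) {f : Hpt n → ℝ} (hf : IsC1H U f)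
    {p : Hpt n} (hp : p ∈ U) (j : Fin n) (c : ℝ) :
    StrictP f p (fun v => hz ((c * v.1 j) • eX j))
      (fun v => (c * v.1 j) * gradH f p ⟨(j:ℕ), by omega⟩) := by
  have h := strict_one hU hf hp ⟨(j:ℕ), by omega⟩
  have hl : Continuous (fun z : Hpt n × HE n => (z.1, c * z.2.1 j)) := by fun_prop
  have ht : Tendsto (fun z : Hpt n × HE n => (z.1, c * z.2.1 j))
      (𝓝 ((p, 0) : Hpt n × HE n)) (𝓝 ((p, 0) : Hpt n × ℝ)) := by
    simpa using hl.tendsto (p, 0)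
  have h2 := h.comp_tendsto ht
  unfold StrictP
  refine (h2.congr_left ?_).trans_isBigO ?_
  · intro z
    simp only [Function.comp, line_X]
  · refine Asymptotics.IsBigO.of_bound |c| (Eventually.of_forall fun z => ?_)
    simp only [Function.comp, norm_mul, Real.norm_eq_abs]
    gcongr
    exact (norm_le_pi_norm z.2.1 j).trans (norm_fst_le z.2)

lemma strict_Y {U : Set (Hpt n)} (hU : IsOpen U) {f : Hpt n → ℝ} (hf : IsC1H U f)
    {p : Hpt n} (hp : p ∈ U) (j : Fin n) :
    StrictP f p (fun v => hz ((v.2 j) • eY j))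
      (fun v => (v.2 j) * gradH f p ⟨n + (j:ℕ), by omega⟩) := by
  have h := strict_one hU hf hp ⟨n + (j:ℕ), by omega⟩
  have hl : Continuous (fun z : Hpt n × HE n => (z.1, z.2.2 j)) := by fun_prop
  have ht : Tendsto (fun z : Hpt n × HE n => (z.1, z.2.2 j))
      (𝓝 ((p, 0) : Hpt n × HE n)) (𝓝 ((p, 0) : Hpt n × ℝ)) := by
    simpa using hl.tendsto (p, 0)
  have h2 := h.comp_tendsto ht
  unfold StrictP
  refine (h2.congr_left ?_).trans_isBigO ?_
  · intro z
    simp only [Function.comp, line_Y]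
  · refine Asymptotics.IsBigO.of_bound 1 (Eventually.of_forall fun z => ?_)
    simp only [Function.comp, one_mul]
    exact (norm_le_pi_norm z.2.2 j).trans (norm_snd_le z.2)

lemma hmul_hz_X (a b : Fin n → ℝ) : hmul (hz (a, 0)) (hz (b, 0)) = hz ((a + b, 0) : HE n) := by
  unfold hmul hz
  simp

lemma hmul_hz_Y (a b : Fin n → ℝ) : hmul (hz (0, a)) (hz (0, b)) = hz ((0, a + b) : HE n) := by
  unfold hmul hz
  simp

lemma continuous_hz : Continuous (hz : HE n → Hpt n) := by
  unfold hz; fun_prop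

lemma hz_zero : hz (0 : HE n) = 0 := rfl

lemma strict_Xs {U : Set (Hpt n)} (hU : IsOpen U) {f : Hpt n → ℝ} (hf : IsC1H U f)
    {p : Hpt n} (hp : p ∈ U) (c : ℝ) (s : Finset (Fin n)) :
    StrictP f p (fun v => hz (∑ j ∈ s, (c * v.1 j) • Pi.single j 1, 0))
      (fun v => ∑ j ∈ s, (c * v.1 j) * gradH f p ⟨(j:ℕ), by omega⟩) := by
  classical
  induction s using Finset.induction_on with
  | empty =>
    unfold StrictP
    simp only [Finset.sum_empty]
    refine (Asymptotics.isLittleO_zero _ _).congr_left fun z => ?_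
    have : hz ((0, 0) : HE n) = 0 := rfl
    rw [this, hmul_zero']
    simp
  | insert i s hi ih =>
    have h := (strict_X hU hf hp i c).comp ih
      (continuous_hz.comp (by fun_prop)) (by simp [hz_zero])
    simp only [Finset.sum_insert hi]
    convert h using 3 with v
    rw [← hmul_hz_X]
    congr 2
    simp [eX]

lemma strict_Ys {U : Set (Hpt n)} (hU : IsOpen U) {f : Hpt n → ℝ} (hf : IsC1H U f)
    {p : Hpt n} (hp : p ∈ U) (s : Finset (Fin n)) :
    StrictP f p (fun v => hz (0, ∑ j ∈ s, (v.2 j) • Pi.single j 1))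
      (fun v => ∑ j ∈ s, (v.2 j) * gradH f p ⟨n + (j:ℕ), by omega⟩) := by
  classical
  induction s using Finset.induction_on with
  | empty =>
    unfold StrictP
    simp only [Finset.sum_empty]
    refine (Asymptotics.isLittleO_zero _ _).congr_left fun z => ?_
    have : hz ((0, 0) : HE n) = 0 := rfl
    rw [this, hmul_zero']
    simp
  | insert i s hi ih =>
    have h := (strict_Y hU hf hp i).comp ih
      (continuous_hz.comp (by fun_prop)) (by simp [hz_zero])
    simp only [Finset.sum_insert hi]
    convert h using 3 with v
    rw [← hmul_hz_Y]
    congr 2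
    simp [eY]

/-- The horizontal differential as a linear functional. -/
def lD (f : Hpt n → ℝ) (p : Hpt n) : HE n →ₗ[ℝ] ℝ where
  toFun v := (∑ j, v.1 j * gradH f p ⟨(j:ℕ), by omega⟩) +
    ∑ j, v.2 j * gradH f p ⟨n + (j:ℕ), by omega⟩
  map_add' v w := by
    simp only [Prod.fst_add, Prod.snd_add, Pi.add_apply, add_mul, Finset.sum_add_distrib]
    ring
  map_smul' c v := by
    simp only [Prod.smul_fst, Prod.smul_snd, Pi.smul_apply, smul_eq_mul, mul_assoc,
      ← Finset.mul_sum, RingHom.id_apply]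
    ring

lemma strict_hz {U : Set (Hpt n)} (hU : IsOpen U) {f : Hpt n → ℝ} (hf : IsC1H U f)
    {p : Hpt n} (hp : p ∈ U) : StrictP f p hz (lD f p) := by
  have hX := strict_Xs hU hf hp (1/2) Finset.univ
  have hY := strict_Ys hU hf hp Finset.univ
  have h := (hX.comp hY (continuous_hz.comp (by fun_prop)) (by simp; rfl)).comp hX
    (continuous_hmul.comp ((continuous_hz.comp (by fun_prop)).prodMk
      (continuous_hz.comp (by fun_prop)))) (by
        simp only [Prod.fst_zero, Prod.snd_zero, Pi.zero_apply, mul_zero, zero_smul,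
          Finset.sum_const_zero]
        have : hz ((0, 0) : HE n) = 0 := rfl
        rw [this, hmul_zero'])
  have e1 : ∀ v : Fin n → ℝ, ∑ j, (1/2 * v j) • (Pi.single j 1 : Fin n → ℝ) = (1/2 : ℝ) • v := by
    intro v
    ext i
    simp [Pi.single_apply]
  have e2 : ∀ v : Fin n → ℝ, ∑ j, (v j) • (Pi.single j 1 : Fin n → ℝ) = v := by
    intro v
    ext i
    simp [Pi.single_apply]
  convert h using 2 with v v
  · rw [e1, e2]
    unfold hmul hz
    refine Prod.ext ?_ (Prod.ext (by simp) ?_)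
    · ext i
      simp
      ring
    · simp [Finset.mul_sum, mul_assoc]
  · simp only [lD, LinearMap.coe_mk, AddHom.coe_mk, mul_assoc, ← Finset.mul_sum]
    ring

/-! ## Part 2: isotropic complements -/

section IsoLin
variable {E : Type*} [AddCommGroup E] [Module ℝ E]

/-- The good case of the inductive step. -/
lemma iso_step (B : E →ₗ[ℝ] E →ₗ[ℝ] ℝ) (hB : ∀ v, B v v = 0)
    {m : ℕ} (l : Fin (m+1) → E →ₗ[ℝ] ℝ) (v : Fin m → E)
    (hv : ∀ i j, B (v i) (v j) = 0)
    (hl : ∀ i j, l (Fin.castSucc i) (v j) = if i = j then 1 else 0)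
    (w : E) (hw : ∀ i, B (v i) w = 0)
    (hw2 : l (Fin.last m) w - ∑ i : Fin m, l (Fin.last m) (v i) * l i.castSucc w ≠ 0) :
    ∃ v : Fin (m+1) → E, (∀ i j, B (v i) (v j) = 0) ∧
      ∀ i j, l i (v j) = if i = j then 1 else 0 := by
  have hs : ∀ a b, B a b = - B b a := by
    intro a b
    have := hB (a + b)
    simp only [map_add, LinearMap.add_apply, hB] at this
    linarith
  set c := l (Fin.last m) w - ∑ i : Fin m, l (Fin.last m) (v i) * l i.castSucc w with hc
  set w1 : E := c⁻¹ • (w - ∑ i : Fin m, l i.castSucc w • v i) with hw1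
  have h1 : ∀ i, l (Fin.castSucc i) w1 = 0 := by
    intro i
    simp [hw1, hl]
  have h2 : l (Fin.last m) w1 = 1 := by
    simp only [hw1, map_smul, map_sub, map_sum, smul_eq_mul]
    rw [inv_mul_eq_one₀ hw2, hc]
    simp only [mul_comm]
  have h3 : ∀ i, B (v i) w1 = 0 := by
    intro i
    simp [hw1, hw, hv]
  have h3' : ∀ i, B w1 (v i) = 0 := by
    intro i
    rw [hs, h3, neg_zero]
  refine ⟨Fin.snoc (fun j => v j - l (Fin.last m) (v j) • w1) w1, ?_, ?_⟩
  · intro i j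
    refine Fin.lastCases ?_ (fun i => ?_) i <;> refine Fin.lastCases ?_ (fun j => ?_) j <;>
    simp [hB, h3, h3', hv]
  · intro i j
    refine Fin.lastCases ?_ (fun i => ?_) i <;> refine Fin.lastCases ?_ (fun j => ?_) j
    · simp [h2]
    · simp [h2, Fin.ext_iff]
      intro h
      omega
    · simp [h1, Fin.ext_iff]
      intro h
      omega
    · simp [h1, hl]

lemma iso_exists [FiniteDimensional ℝ E] (B : E →ₗ[ℝ] E →ₗ[ℝ] ℝ) (hB : ∀ v, B v v = 0)
    (hnd : ∀ v, (∀ w, B v w = 0) → v = 0) {N : ℕ} (hN : 2 * N ≤ Module.finrank ℝ E) (m : ℕ) :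
    ∀ (_ : m ≤ N) (l : Fin m → E →ₗ[ℝ] ℝ) (_ : LinearIndependent ℝ l),
      ∃ v : Fin m → E, (∀ i j, B (v i) (v j) = 0) ∧
        ∀ i j, l i (v j) = if i = j then 1 else 0 := by
  induction m with
  | zero =>
    intro _ l _
    exact ⟨fun i => i.elim0, fun i => i.elim0, fun i => i.elim0⟩
  | succ m ih =>
    intro hm l hli
    have hs : ∀ a b, B a b = - B b a := by
      intro a b
      have := hB (a + b)
      simp only [map_add, LinearMap.add_apply, hB] at this
      linarith
    obtain ⟨v, hv, hl⟩ := ih (by omega) (fun i => l i.castSucc)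
      (hli.comp _ (Fin.castSucc_injective m))
    let l' : E →ₗ[ℝ] ℝ := l (Fin.last m) - ∑ i : Fin m, l (Fin.last m) (v i) • l i.castSucc
    have hl'e : ∀ w, l' w = l (Fin.last m) w - ∑ i : Fin m, l (Fin.last m) (v i) * l i.castSucc w := by
      intro w
      simp [l']
    have hl'0 : l' ≠ 0 := by
      intro h0
      have hmem : l (Fin.last m) ∈ Submodule.span ℝ (range fun i : Fin m => l i.castSucc) := by
        rw [sub_eq_zero.1 h0]
        exact Submodule.sum_mem _ fun i _ => Submodule.smul_mem _ _ (Submodule.subset_span ⟨i, rfl⟩)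
      have h1 : LinearIndependent ℝ (Fin.snoc (fun i : Fin m => l i.castSucc) (l (Fin.last m)) :
          Fin (m+1) → E →ₗ[ℝ] ℝ) := by
        convert hli using 1
        exact Fin.snoc_init_self l
      exact (linearIndependent_finSnoc.1 h1).2 hmem
    by_cases hA : ∃ w, (∀ i, B (v i) w = 0) ∧ l' w ≠ 0
    · obtain ⟨w, hw, hw2⟩ := hA
      rw [hl'e] at hw2
      exact iso_step B hB l v hv hl w hw hw2
    push Not at hA
    -- `l'` is a combination of the `B (v i)`
    have hspan : l' ∈ Submodule.span ℝ (range fun i => B (v i)) := by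
      apply mem_span_of_iInf_ker_le_ker
      intro w hw
      simp only [Submodule.mem_iInf, LinearMap.mem_ker] at hw ⊢
      exact hA w hw
    obtain ⟨b, hb⟩ := (Submodule.mem_span_range_iff_exists_fun ℝ).1 hspan
    have hbj : ∃ j, b j ≠ 0 := by
      by_contra h
      push Not at h
      apply hl'0
      rw [← hb]
      simp [h]
    obtain ⟨j0, hj0⟩ := hbj
    -- a nonzero `z`
    obtain ⟨z, hz, hz0⟩ : ∃ z, ((∀ i, B (v i) z = 0) ∧ ∀ i : Fin m, l i.castSucc z = 0) ∧ z ≠ 0 := by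
      let T : E →ₗ[ℝ] (Fin m → ℝ) × (Fin m → ℝ) :=
        (LinearMap.pi fun i => B (v i)).prod (LinearMap.pi fun i => l i.castSucc)
      have hlt : Module.finrank ℝ ((Fin m → ℝ) × (Fin m → ℝ)) < Module.finrank ℝ E := by
        simp
        omega
      have hk := LinearMap.ker_ne_bot_of_finrank_lt (f := T) hlt
      obtain ⟨z, hz, hz0⟩ := (Submodule.ne_bot_iff _).1 hk
      refine ⟨z, ?_, hz0⟩
      have hT : T z = 0 := hz
      exact ⟨fun i => congrFun (congrArg Prod.fst hT) i, fun i => congrFun (congrArg Prod.snd hT) i⟩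
    have hz' : ∀ i, B z (v i) = 0 := fun i => by rw [hs, hz.1, neg_zero]
    have hl'z : l' z = 0 := hA z hz.1
    let u : Fin m → E := fun i => v i + (if i = j0 then (1:ℝ) else 0) • z
    have hu : ∀ i j, B (u i) (u j) = 0 := by
      intro i j
      simp [u, hv, hB, hz.1, hz', -ite_smul]
    have hlu : ∀ i j, l (Fin.castSucc i) (u j) = if i = j then 1 else 0 := by
      intro i j
      simp [u, hl, hz.2, -ite_smul]
    have hlast : ∀ i, l (Fin.last m) (u i) = l (Fin.last m) (v i) := by
      intro i
      have : l (Fin.last m) z = 0 := by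
        have := hl'z
        rw [hl'e] at this
        simpa [hz.2] using this
      simp [u, this, -ite_smul]
    by_cases hA2 : ∃ w, (∀ i, B (u i) w = 0) ∧ l' w ≠ 0
    · obtain ⟨w, hw, hw2⟩ := hA2
      rw [hl'e] at hw2
      simp only [← hlast] at hw2
      exact iso_step B hB l u hu hlu w hw hw2
    exfalso
    push Not at hA2
    have hspan2 : l' ∈ Submodule.span ℝ (range fun i => B (u i)) := by
      apply mem_span_of_iInf_ker_le_ker
      intro w hw
      simp only [Submodule.mem_iInf, LinearMap.mem_ker] at hw ⊢
      exact hA2 w hw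
    obtain ⟨b', hb'⟩ := (Submodule.mem_span_range_iff_exists_fun ℝ).1 hspan2
    have heq : ∑ i, b i • v i = ∑ i, b' i • u i := by
      rw [← sub_eq_zero]
      apply hnd
      intro w
      have h1 := congrArg (fun L : E →ₗ[ℝ] ℝ => L w) (hb.trans hb'.symm)
      simp only [LinearMap.sum_apply, LinearMap.smul_apply] at h1
      simp only [map_sub, map_sum, map_smul, LinearMap.sub_apply, LinearMap.sum_apply,
        LinearMap.smul_apply, h1, sub_self]
    have hbb : ∀ i, b i = b' i := by
      intro i
      have h1 := congrArg (l i.castSucc) heq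
      simpa [map_sum, hl, hlu] using h1
    have : b' j0 • z = 0 := by
      have h2 : ∑ i, b' i • u i = ∑ i, b' i • v i + b' j0 • z := by
        simp [u, smul_add, Finset.sum_add_distrib]
      rw [h2] at heq
      simp only [hbb] at heq
      simpa using heq
    rcases smul_eq_zero.1 this with h | h
    · exact hj0 (by rw [hbb, h])
    · exact hz0 h

end IsoLin

/-! ## Part 3: foliation by horizontal planes -/

/-- The standard symplectic form. -/
def omg (n : ℕ) : HE n →ₗ[ℝ] HE n →ₗ[ℝ] ℝ :=
  LinearMap.mk₂ ℝ (fun v w => (∑ j, v.1 j * w.2 j) - ∑ j, w.1 j * v.2 j)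
    (by intro a b c; simp only [Prod.fst_add, Prod.snd_add, Pi.add_apply, add_mul, mul_add,
          Finset.sum_add_distrib]; ring)
    (by intro r a b; simp only [Prod.smul_fst, Prod.smul_snd, Pi.smul_apply, smul_eq_mul,
          mul_sub, Finset.mul_sum]; congr 1 <;> exact Finset.sum_congr rfl fun _ _ => by ring)
    (by intro a b c; simp only [Prod.fst_add, Prod.snd_add, Pi.add_apply, add_mul, mul_add,
          Finset.sum_add_distrib]; ring)
    (by intro r a b; simp only [Prod.smul_fst, Prod.smul_snd, Pi.smul_apply, smul_eq_mul,
          mul_sub, Finset.mul_sum]; congr 1 <;> exact Finset.sum_congr rfl fun _ _ => by ring)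

lemma omg_apply (v w : HE n) : omg n v w = (∑ j, v.1 j * w.2 j) - ∑ j, w.1 j * v.2 j := rfl

lemma omg_nd (v : HE n) (h : ∀ w, omg n v w = 0) : v = 0 := by
  refine Prod.ext ?_ ?_ <;> ext j
  · have := h (eY j)
    simpa [omg_apply, eY, Pi.single_apply] using this
  · have := h (eX j)
    simpa [omg_apply, eX, Pi.single_apply] using this

lemma hmul_hz {v w : HE n} (h : omg n v w = 0) : hmul (hz v) (hz w) = hz (v + w) := by
  rw [omg_apply] at h
  unfold hmul hz
  refine Prod.ext (by simp) (Prod.ext (by simp) ?_)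
  simp only
  linarith

lemma lD_eX (f : Hpt n → ℝ) (p : Hpt n) (j : Fin n) :
    lD f p (eX j) = gradH f p ⟨(j:ℕ), by omega⟩ := by
  simp [lD, eX, Pi.single_apply]

lemma lD_eY (f : Hpt n → ℝ) (p : Hpt n) (j : Fin n) :
    lD f p (eY j) = gradH f p ⟨n + (j:ℕ), by omega⟩ := by
  simp [lD, eY, Pi.single_apply]

lemma lD_li {m : ℕ} {F : Fin m → Hpt n → ℝ} {p : Hpt n}
    (h : LinearIndependent ℝ (fun i => gradH (F i) p)) :
    LinearIndependent ℝ (fun i => lD (F i) p) := by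
  rw [Fintype.linearIndependent_iff] at h ⊢
  intro g hg
  apply h g
  ext j
  by_cases hj : (j:ℕ) < n
  · have hje : j = (⟨((⟨j, hj⟩ : Fin n):ℕ), by omega⟩ : Fin (2*n)) := rfl
    have := congrArg (fun L : HE n →ₗ[ℝ] ℝ => L (eX ⟨j, hj⟩)) hg
    simpa [LinearMap.sum_apply, lD_eX] using this
  · have hje : j = (⟨n + ((⟨(j:ℕ) - n, by omega⟩ : Fin n):ℕ), by omega⟩ : Fin (2*n)) := by
      apply Fin.ext; simp; omega
    have := congrArg (fun L : HE n →ₗ[ℝ] ℝ => L (eY ⟨(j:ℕ) - n, by omega⟩)) hg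
    simp only [LinearMap.sum_apply, LinearMap.smul_apply, lD_eY, ← hje] at this
    simpa using this

lemma exists_W {m : ℕ} (hm : m ≤ n) {F : Fin m → Hpt n → ℝ} {p : Hpt n}
    (h : LinearIndependent ℝ (fun i => gradH (F i) p)) :
    ∃ W : (Fin m → ℝ) →ₗ[ℝ] HE n, (∀ a b, omg n (W a) (W b) = 0) ∧
      ∀ i a, lD (F i) p (W a) = a i := by
  obtain ⟨v, hv, hl⟩ := iso_exists (omg n) (fun v => by rw [omg_apply, sub_self]) omg_nd
    (N := n) (by simp; omega) m hm _ (lD_li h)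
  refine ⟨Fintype.linearCombination ℝ v, ?_, ?_⟩
  · intro a b
    simp [Fintype.linearCombination_apply, map_sum, hv]
  · intro i a
    simp [Fintype.linearCombination_apply, map_sum, hl]

/-- Right translation by `exp (W a)`. -/
def act {m : ℕ} (W : (Fin m → ℝ) →ₗ[ℝ] HE n) (q : Hpt n) (a : Fin m → ℝ) : Hpt n :=
  hmul q (hz (W a))

lemma act_zero {m : ℕ} (W : (Fin m → ℝ) →ₗ[ℝ] HE n) (q : Hpt n) : act W q 0 = q := by
  unfold act
  rw [map_zero, hz_zero, hmul_zero']

lemma act_add {m : ℕ} {W : (Fin m → ℝ) →ₗ[ℝ] HE n} (hW : ∀ a b, omg n (W a) (W b) = 0)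
    (q : Hpt n) (a b : Fin m → ℝ) : act W (act W q a) b = act W q (a + b) := by
  unfold act
  rw [hmul_assoc', hmul_hz (hW a b), map_add]

lemma continuous_act {m : ℕ} (W : (Fin m → ℝ) →ₗ[ℝ] HE n) :
    Continuous fun z : Hpt n × (Fin m → ℝ) => act W z.1 z.2 := by
  unfold act
  have hW : Continuous W := W.continuous_of_finiteDimensional
  exact continuous_hmul.comp (continuous_fst.prodMk (continuous_hz.comp (hW.comp continuous_snd)))

lemma tendsto_act {m : ℕ} (W : (Fin m → ℝ) →ₗ[ℝ] HE n) (p : Hpt n) :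
    Tendsto (fun z : Hpt n × (Fin m → ℝ) => act W z.1 z.2) (𝓝 (p, 0)) (𝓝 p) := by
  have := (continuous_act W).tendsto (p, 0)
  simpa [act_zero] using this

/-- neighbourhood version of continuity of the action -/
lemma act_nhds {m : ℕ} (W : (Fin m → ℝ) →ₗ[ℝ] HE n) {p : Hpt n} {U : Set (Hpt n)}
    (hU : U ∈ 𝓝 p) : ∃ r > 0, ∀ q ∈ Metric.ball p r, ∀ a, ‖a‖ < r → act W q a ∈ U := by
  have h := (tendsto_act W p) hU
  rw [mem_map, Metric.mem_nhds_iff] at h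
  obtain ⟨r, hr, h⟩ := h
  refine ⟨r, hr, fun q hq a ha => h (a := (q, a)) ?_⟩
  rw [Metric.mem_ball, Prod.dist_eq, max_lt_iff]
  exact ⟨hq, by simpa using ha⟩

/-- strict differentiability of a vector valued map along the action -/
def StrictA {m m' : ℕ} (W : (Fin m → ℝ) →ₗ[ℝ] HE n) (p : Hpt n) (H : Hpt n → Fin m' → ℝ)
    (M : (Fin m → ℝ) → (Fin m' → ℝ)) : Prop :=
  (fun z : Hpt n × (Fin m → ℝ) => H (act W z.1 z.2) - H z.1 - M z.2)
    =o[𝓝 (p, 0)] fun z => z.2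

lemma strictA {m m' : ℕ} (W : (Fin m → ℝ) →ₗ[ℝ] HE n) {U : Set (Hpt n)} (hU : IsOpen U)
    {p : Hpt n} (hp : p ∈ U) {F : Fin m' → Hpt n → ℝ} (hF : ∀ i, IsC1H U (F i)) :
    StrictA W p (fun q i => F i q) (fun a i => lD (F i) p (W a)) := by
  unfold StrictA
  rw [Asymptotics.isLittleO_pi]
  intro i
  have h := strict_hz hU (hF i) hp
  unfold StrictP at h
  have hW : Continuous W := W.continuous_of_finiteDimensional
  have hc : Continuous (fun z : Hpt n × (Fin m → ℝ) => (z.1, W z.2)) := by fun_prop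
  have ht : Tendsto (fun z : Hpt n × (Fin m → ℝ) => (z.1, W z.2))
      (𝓝 ((p, 0))) (𝓝 ((p, 0) : Hpt n × HE n)) := by
    simpa using hc.tendsto (p, 0)
  refine (h.comp_tendsto ht).trans_isBigO ?_
  have := (LinearMap.toContinuousLinearMap W).isBigO_comp (fun z : Hpt n × (Fin m → ℝ) => z.2)
    (𝓝 (p, 0))
  exact this

lemma chart_id {m : ℕ} {W : (Fin m → ℝ) →ₗ[ℝ] HE n} (hW : ∀ a b, omg n (W a) (W b) = 0)
    {p : Hpt n} {H : Hpt n → Fin m → ℝ} (hs : StrictA W p H id) :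
    ∃ N ∈ 𝓝 p, ∃ δ > 0,
      (∀ q ∈ N, ∀ a b, ‖a‖ ≤ δ → ‖b‖ ≤ δ → ‖a - b‖ ≤ 2 * ‖H (act W q a) - H (act W q b)‖) ∧
      (∀ q ∈ N, ∀ c, 2 * ‖c - H q‖ ≤ δ → ∃ a, ‖a‖ ≤ 2 * ‖c - H q‖ ∧ H (act W q a) = c) := by
  unfold StrictA at hs
  have h1 := hs.def (show (0:ℝ) < 1/2 by norm_num)
  rw [Metric.eventually_nhds_iff_ball] at h1
  obtain ⟨r, hr, h1⟩ := h1
  obtain ⟨r', hr', h2⟩ := act_nhds W (Metric.ball_mem_nhds p hr)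
  set δ := min r r' / 4 with hδ
  have hδ0 : 0 < δ := by positivity
  have hδr : δ + δ < r := by
    have := min_le_left r r'
    have := lt_min hr hr'
    rw [hδ]; linarith
  have hδr' : δ < r' := by
    have := min_le_right r r'
    have := lt_min hr hr'
    rw [hδ]; linarith
  have key : ∀ q ∈ Metric.ball p r', ∀ a b, ‖a‖ ≤ δ → ‖b‖ ≤ δ →
      ‖H (act W q a) - H (act W q b) - (a - b)‖ ≤ 1/2 * ‖a - b‖ := by
    intro q hq a b ha hb
    have h3 := h2 q hq b (lt_of_le_of_lt hb hδr')
    have hab : ‖a - b‖ < r := lt_of_le_of_lt ((norm_sub_le a b).trans (add_le_add ha hb)) hδr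
    have h4 := h1 (act W q b, a - b) (by
      rw [Metric.mem_ball, Prod.dist_eq, max_lt_iff]
      exact ⟨h3, by simpa using hab⟩)
    simp only [act_add hW, id] at h4
    rwa [add_sub_cancel] at h4
  refine ⟨Metric.ball p r', Metric.ball_mem_nhds p hr', δ, hδ0, ?_, ?_⟩
  · intro q hq a b ha hb
    have h3 := key q hq a b ha hb
    have h4 := norm_sub_norm_le (a - b) (H (act W q a) - H (act W q b))
    rw [norm_sub_rev (a - b) (H (act W q a) - H (act W q b))] at h4
    linarith
  · intro q hq c hc
    have happ : ApproximatesLinearOn (fun a => H (act W q a)) (ContinuousLinearMap.id ℝ (Fin m → ℝ))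
        (Metric.closedBall 0 δ) (1/2) := by
      intro a ha b hb
      have := key q hq a b (by simpa using ha) (by simpa using hb)
      simpa using this
    let inv : (ContinuousLinearMap.id ℝ (Fin m → ℝ)).NonlinearRightInverse :=
      { toFun := id
        nnnorm := 1
        bound' := by intro y; simp
        right_inv' := by intro y; rfl }
    have hsurj := happ.surjOn_closedBall_of_nonlinearRightInverse inv (ε := 2 * ‖c - H q‖) (b := 0)
      (by positivity) (Metric.closedBall_subset_closedBall hc)
    have hcm : c ∈ Metric.closedBall (H (act W q 0))
        (((inv.nnnorm : ℝ)⁻¹ - ((1/2 : NNReal) : ℝ)) * (2 * ‖c - H q‖)) := by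
      rw [act_zero, Metric.mem_closedBall, dist_eq_norm]
      have : (inv.nnnorm : ℝ) = 1 := rfl
      rw [this]
      push_cast
      linarith
    obtain ⟨a, ha, hac⟩ := hsurj hcm
    exact ⟨a, by simpa using ha, hac⟩

lemma chart {m : ℕ} {W : (Fin m → ℝ) →ₗ[ℝ] HE n} (hW : ∀ a b, omg n (W a) (W b) = 0)
    {p : Hpt n} {H : Hpt n → Fin m → ℝ} (M : (Fin m → ℝ) ≃L[ℝ] (Fin m → ℝ))
    (hs : StrictA W p H M) :
    ∃ N ∈ 𝓝 p, ∃ δ > 0, ∃ K > 0,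
      (∀ q ∈ N, ∀ a b, ‖a‖ ≤ δ → ‖b‖ ≤ δ → ‖a - b‖ ≤ K * ‖H (act W q a) - H (act W q b)‖) ∧
      (∀ q ∈ N, ∀ c, K * ‖c - H q‖ ≤ δ → ∃ a, ‖a‖ ≤ K * ‖c - H q‖ ∧ H (act W q a) = c) := by
  let Ms : (Fin m → ℝ) →L[ℝ] (Fin m → ℝ) := M.symm
  have hs' : StrictA W p (fun q => Ms (H q)) id := by
    unfold StrictA at hs ⊢
    have h := (Ms.isBigO_comp (fun z : Hpt n × (Fin m → ℝ) =>
      H (act W z.1 z.2) - H z.1 - M z.2) (𝓝 (p, 0))).trans_isLittleO hs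
    refine h.congr_left fun z => ?_
    simp [Ms]
  obtain ⟨N, hN, δ, hδ, h1, h2⟩ := chart_id hW hs'
  have hle : ∀ x, 2 * ‖Ms x‖ ≤ 2 * (‖Ms‖ + 1) * ‖x‖ := by
    intro x
    have := Ms.le_opNorm x
    have := norm_nonneg x
    nlinarith
  refine ⟨N, hN, δ, hδ, 2 * (‖Ms‖ + 1), by positivity, ?_, ?_⟩
  · intro q hq a b ha hb
    refine (h1 q hq a b ha hb).trans ?_
    rw [← map_sub]
    exact hle _
  · intro q hq c hc
    have hle' := hle (c - H q)
    rw [map_sub] at hle'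
    obtain ⟨a, ha, hac⟩ := h2 q hq (Ms c) (hle'.trans hc)
    exact ⟨a, ha.trans hle', M.symm.injective hac⟩


/-! ## Part 5: homogeneous distances induce the Euclidean topology -/

lemma hmul_hinv (p : Hpt n) : hmul (hinv p) p = 0 := by
  unfold hmul hinv
  refine Prod.ext (by simp) (Prod.ext (by simp) ?_)
  simp [Finset.sum_neg_distrib]

lemma dist_left (D : HomDist n) (p q : Hpt n) : D.d p q = D.d 0 (hmul (hinv p) q) := by
  rw [← D.leftInv (hinv p) p q, hmul_hinv]

lemma d_nonneg (D : HomDist n) (p q : Hpt n) : 0 ≤ D.d p q := by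
  have h1 := D.triangle p q p
  rw [(D.eq_iff p p).2 rfl, D.symm q p] at h1
  linarith

lemma d_hmul_le (D : HomDist n) (p q : Hpt n) : D.d 0 (hmul p q) ≤ D.d 0 p + D.d 0 q := by
  have h1 := D.triangle 0 p (hmul p q)
  have h2 := D.leftInv p 0 q
  rw [hmul_zero'] at h2
  linarith

/-- horizontal radius -/
def hrad (p : Hpt n) : ℝ := Real.sqrt (∑ j, (p.1 j ^ 2 + p.2.1 j ^ 2))

lemma d_horiz (D : HomDist n) (hn : 1 ≤ n) : ∃ c > 0, ∀ p : Hpt n, p.2.2 = 0 →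
    D.d 0 p = hrad p * c := by
  let j0 : Fin n := ⟨0, hn⟩
  let e : Hpt n := (Pi.single j0 1, 0, 0)
  have he : e ≠ 0 := by
    intro h
    have := congrFun (congrArg Prod.fst h) j0
    simp [e] at this
  refine ⟨D.d 0 e, lt_of_le_of_ne (d_nonneg D 0 e) fun h => he ((D.eq_iff 0 e).1 h.symm).symm, ?_⟩
  intro p hp
  have hs0 : 0 ≤ ∑ j, (p.1 j ^ 2 + p.2.1 j ^ 2) := Finset.sum_nonneg fun j _ => by positivity
  have h1 : D.d 0 p = D.d 0 (hdil (hrad p) e) := by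
    apply D.rotInv
    · simp only [hdil, e, hrad]
      simp only [Pi.smul_apply, smul_eq_mul, mul_pow, Pi.zero_apply, Real.sq_sqrt hs0]
      generalize ∑ j, (p.1 j ^ 2 + p.2.1 j ^ 2) = A
      symm
      rw [Finset.sum_eq_single j0]
      · simp
      · intro b _ hb
        simp [hb]
      · simp
    · simp [hdil, e, hp]
  rcases (Real.sqrt_nonneg (∑ j, (p.1 j ^ 2 + p.2.1 j ^ 2))).eq_or_lt with h | h
  · have h2 : hrad p = 0 := h.symm
    rw [h1, h2, zero_mul]
    have : hdil 0 e = 0 := by simp [hdil]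
    rw [this]
    exact (D.eq_iff 0 0).2 rfl
  · have h2 := D.homog (hrad p) h 0 e
    have h3 : hdil (hrad p) (0 : Hpt n) = 0 := by simp [hdil]
    rw [h3] at h2
    rw [h1, h2]

lemma d_vert (D : HomDist n) : ∃ c > 0, ∀ t : ℝ,
    D.d 0 ((0, 0, t) : Hpt n) = Real.sqrt |t| * c := by
  let e : Hpt n := (0, 0, 1)
  have he : e ≠ 0 := by
    intro h
    have := congrArg (fun p : Hpt n => p.2.2) h
    simp [e] at this
  have hpos : ∀ t : ℝ, 0 ≤ t → D.d 0 ((0, 0, t) : Hpt n) = Real.sqrt t * D.d 0 e := by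
    intro t ht
    have h3 : ∀ l, hdil l (0 : Hpt n) = 0 := fun l => by simp [hdil]
    rcases ht.eq_or_lt with h | h
    · rw [← h, Real.sqrt_zero, zero_mul]
      exact (D.eq_iff 0 _).2 rfl
    · have h2 := D.homog (Real.sqrt t) (Real.sqrt_pos.2 h) 0 e
      rw [h3] at h2
      rw [← h2]
      congr 1
      simp [hdil, e, Real.sq_sqrt ht]
  have hneg : ∀ t : ℝ, D.d 0 ((0, 0, -t) : Hpt n) = D.d 0 ((0, 0, t) : Hpt n) := by
    intro t
    have h1 := D.leftInv (0, 0, t) 0 (0, 0, -t)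
    rw [hmul_zero'] at h1
    have h2 : hmul ((0, 0, t) : Hpt n) (0, 0, -t) = 0 := by simp [hmul]
    rw [h2, D.symm] at h1
    exact h1.symm
  refine ⟨D.d 0 e, lt_of_le_of_ne (d_nonneg D 0 e) fun h => he ((D.eq_iff 0 e).1 h.symm).symm, ?_⟩
  intro t
  rcases le_total 0 t with h | h
  · rw [abs_of_nonneg h, hpos t h]
  · rw [abs_of_nonpos h, ← hneg, hpos (-t) (by linarith)]

lemma split_hv (p : Hpt n) : hmul (p.1, p.2.1, 0) (0, 0, p.2.2) = p := by
  unfold hmul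
  refine Prod.ext (by simp) (Prod.ext (by simp) ?_)
  simp

lemma continuous_hrad : Continuous (hrad : Hpt n → ℝ) := by
  unfold hrad
  fun_prop

lemma continuous_hinv_hmul (p : Hpt n) : Continuous fun q => hmul (hinv p) q :=
  continuous_hmul.comp (continuous_const.prodMk continuous_id)

lemma hball_nhds (D : HomDist n) (hn : 1 ≤ n) (p : Hpt n) {r : ℝ} (hr : 0 < r) :
    hball D p r ∈ 𝓝 p := by
  obtain ⟨c, hc, h1⟩ := d_horiz D hn
  obtain ⟨c', hc', h2⟩ := d_vert D
  have hub : ∀ q : Hpt n, D.d 0 q ≤ hrad q * c + Real.sqrt |q.2.2| * c' := by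
    intro q
    have h3 := d_hmul_le D (q.1, q.2.1, 0) (0, 0, q.2.2)
    rw [split_hv, h1 (q.1, q.2.1, 0) rfl, h2] at h3
    exact h3
  have hcont : Continuous fun q : Hpt n => hrad (hmul (hinv p) q) * c +
      Real.sqrt |(hmul (hinv p) q).2.2| * c' := by
    have h3 := continuous_hinv_hmul p
    have h4 := continuous_hrad (n := n).comp h3
    have h5 : Continuous fun q : Hpt n => (hmul (hinv p) q).2.2 := by fun_prop
    exact (h4.mul continuous_const).add
      ((Real.continuous_sqrt.comp h5.abs).mul continuous_const)
  have hlt := hcont.tendsto p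
  rw [hmul_hinv] at hlt
  have h0 : hrad (0 : Hpt n) = 0 := by simp [hrad]
  rw [h0] at hlt
  simp only [Prod.snd_zero, abs_zero, Real.sqrt_zero, zero_mul, add_zero] at hlt
  filter_upwards [hlt.eventually (gt_mem_nhds hr)] with q hq
  change D.d p q < r
  rw [dist_left]
  exact (hub _).trans_lt hq

lemma exists_hball_subset (D : HomDist n) (hn : 1 ≤ n) (p : Hpt n) {V : Set (Hpt n)}
    (hV : V ∈ 𝓝 p) : ∃ r > 0, hball D p r ⊆ V := by
  obtain ⟨c, hc, h1⟩ := d_horiz D hn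
  obtain ⟨c', hc', h2⟩ := d_vert D
  have hsym : ∀ q : Hpt n, D.d 0 (-q.1, -q.2.1, q.2.2) = D.d 0 q := by
    intro q
    apply D.rotInv <;> simp
  -- vertical part
  have hv : ∀ q : Hpt n, Real.sqrt |q.2.2| * c' ≤ 2 * D.d 0 q := by
    intro q
    have h3 := d_hmul_le D q (-q.1, -q.2.1, q.2.2)
    rw [hsym] at h3
    have h4 : hmul q (-q.1, -q.2.1, q.2.2) = (0, 0, 2 * q.2.2) := by
      unfold hmul
      refine Prod.ext (by simp) (Prod.ext (by simp) ?_)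
      simp [Finset.sum_neg_distrib]
      ring
    rw [h4, h2] at h3
    have h5 : Real.sqrt |q.2.2| ≤ Real.sqrt |2 * q.2.2| := by
      apply Real.sqrt_le_sqrt
      rw [abs_mul]
      have := abs_nonneg q.2.2
      norm_num
      linarith
    nlinarith
  have hh : ∀ q : Hpt n, hrad q * c ≤ 3 * D.d 0 q := by
    intro q
    have h3 := d_hmul_le D q (0, 0, -q.2.2)
    have h4 : hmul q (0, 0, -q.2.2) = (q.1, q.2.1, 0) := by
      unfold hmul
      refine Prod.ext (by simp) (Prod.ext (by simp) ?_)
      simp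
    rw [h4, h1 _ rfl, h2, abs_neg] at h3
    have h5 := hv q
    have h6 : hrad ((q.1, q.2.1, 0) : Hpt n) = hrad q := rfl
    rw [h6] at h3
    linarith
  -- norm bounds
  have hx : ∀ (q : Hpt n) j, |q.1 j| ≤ hrad q ∧ |q.2.1 j| ≤ hrad q := by
    intro q j
    have hle : q.1 j ^ 2 + q.2.1 j ^ 2 ≤ ∑ j, (q.1 j ^ 2 + q.2.1 j ^ 2) :=
      Finset.single_le_sum (f := fun j => q.1 j ^ 2 + q.2.1 j ^ 2)
        (fun j _ => by positivity) (Finset.mem_univ j)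
    constructor <;> apply Real.abs_le_sqrt <;>
      nlinarith [sq_nonneg (q.1 j), sq_nonneg (q.2.1 j)]
  have hV' : (fun q => hmul p q) ⁻¹' V ∈ 𝓝 (0 : Hpt n) := by
    have hct : Continuous fun q => hmul p q :=
      continuous_hmul.comp (continuous_const.prodMk continuous_id)
    apply hct.continuousAt
    show V ∈ 𝓝 (hmul p 0)
    rwa [hmul_zero']
  obtain ⟨s, hs, hsV⟩ := Metric.mem_nhds_iff.1 hV'
  set r := min (s * c / 4) (Real.sqrt (s / 2) * c' / 2) with hr
  have hr0 : 0 < r := by positivity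
  refine ⟨r, hr0, fun q hq => ?_⟩
  have hq' : D.d 0 (hmul (hinv p) q) < r := by
    rw [← dist_left]; exact hq
  set u := hmul (hinv p) q with hu
  have hpu : hmul p u = q := by
    rw [hu, ← hmul_assoc']
    have : hmul p (hinv p) = 0 := by
      have := hmul_hinv (hinv p)
      simpa [hinv] using this
    rw [this, zero_hmul']
  have hu1 : hrad u < s := by
    have h3 := hh u
    have h4 : r ≤ s * c / 4 := min_le_left _ _
    have h5 : hrad u * c < s * c := by
      have := mul_pos hs hc
      linarith
    exact lt_of_mul_lt_mul_right h5 hc.le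
  have hu2 : |u.2.2| < s := by
    have h3 := hv u
    have h4 : r ≤ Real.sqrt (s / 2) * c' / 2 := min_le_right _ _
    have h5 : Real.sqrt |u.2.2| * c' < Real.sqrt (s / 2) * c' := by linarith
    have h6 := lt_of_mul_lt_mul_right h5 hc'.le
    have h7 := (Real.sqrt_lt_sqrt_iff (abs_nonneg _)).1 h6
    linarith
  have : u ∈ Metric.ball (0 : Hpt n) s := by
    rw [mem_ball_zero_iff, Prod.norm_def, max_lt_iff, Prod.norm_def, max_lt_iff]
    refine ⟨(pi_norm_lt_iff hs).2 fun j => (hx u j).1.trans_lt hu1,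
      (pi_norm_lt_iff hs).2 fun j => (hx u j).2.trans_lt hu1, hu2⟩
  have := hsV this
  rwa [mem_preimage, hpu] at this


/-! ## Part 4: consequences of the charts -/

lemma chart_F {m : ℕ} (hm : m ≤ n) {U : Set (Hpt n)} (hU : IsOpen U) {p : Hpt n} (hp : p ∈ U)
    {F : Fin m → Hpt n → ℝ} (hF : ∀ i, IsC1H U (F i))
    (hli : LinearIndependent ℝ (fun i => gradH (F i) p)) :
    ∃ W : (Fin m → ℝ) →ₗ[ℝ] HE n, (∀ a b, omg n (W a) (W b) = 0) ∧
      (∀ i a, lD (F i) p (W a) = a i) ∧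
    ∃ N ∈ 𝓝 p, ∃ δ > 0, ∃ K > 0,
      (∀ q ∈ N, ∀ a b, ‖a‖ ≤ δ → ‖b‖ ≤ δ →
        ‖a - b‖ ≤ K * ‖(fun i => F i (act W q a)) - (fun i => F i (act W q b))‖) ∧
      (∀ q ∈ N, ∀ c, K * ‖c - (fun i => F i q)‖ ≤ δ →
        ∃ a, ‖a‖ ≤ K * ‖c - (fun i => F i q)‖ ∧ (fun i => F i (act W q a)) = c) := by
  obtain ⟨W, hW, hl⟩ := exists_W hm hli
  have hs := strictA W hU hp hF
  have hs' : StrictA W p (fun q i => F i q) (ContinuousLinearEquiv.refl ℝ (Fin m → ℝ)) := by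
    convert hs using 1
    ext a i
    simp [hl]
  exact ⟨W, hW, hl, chart hW _ hs'⟩

lemma contAt_vec {m : ℕ} {U : Set (Hpt n)} (hU : IsOpen U) {p : Hpt n} (hp : p ∈ U)
    {F : Fin m → Hpt n → ℝ} (hF : ∀ i, IsC1H U (F i)) :
    ContinuousAt (fun q i => F i q) p :=
  continuousAt_pi.2 fun i => (hF i).contOn.continuousAt (hU.mem_nhds hp)

lemma tangent {m : ℕ} (hm : m ≤ n) {U : Set (Hpt n)} (hU : IsOpen U) {p : Hpt n} (hp : p ∈ U)
    {G : Fin m → Hpt n → ℝ} (hG : ∀ i, IsC1H U (G i))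
    (hli : LinearIndependent ℝ (fun i => gradH (G i) p)) (hG0 : ∀ i, G i p = 0)
    {h : Hpt n → ℝ} (hh : IsC1H U h) (hGh : ∀ q ∈ U, (∀ i, G i q = 0) → h q = 0)
    {v : HE n} (hv : ∀ i, lD (G i) p v = 0) : lD h p v = 0 := by
  obtain ⟨W, hW, hl, N, hN, δ, hδ, K, hK, -, hsurj⟩ := chart_F hm hU hp hG hli
  let γ : ℝ → Hpt n := fun s => hmul p (hz (s • v))
  have hγc : Continuous γ :=
    continuous_hmul.comp (continuous_const.prodMk (continuous_hz.comp (by fun_prop)))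
  have hγ0 : γ 0 = p := by
    simp only [γ, zero_smul, hz_zero, hmul_zero']
  have hγ : Tendsto γ (𝓝 0) (𝓝 p) := by
    have := hγc.tendsto 0
    rwa [hγ0] at this
  have hpv : Tendsto (fun s : ℝ => (p, s • v)) (𝓝 0) (𝓝 ((p, 0) : Hpt n × HE n)) := by
    have hc : Continuous (fun s : ℝ => (p, s • v)) := by fun_prop
    simpa using hc.tendsto 0
  have hO : (fun s : ℝ => s • v) =O[𝓝 0] fun s => s := by
    refine Asymptotics.IsBigO.of_bound ‖v‖ (Eventually.of_forall fun s => ?_)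
    rw [norm_smul, mul_comm]
  have hGo : (fun s => (fun i => G i (γ s))) =o[𝓝 0] fun s : ℝ => s := by
    rw [Asymptotics.isLittleO_pi]
    intro i
    have h1 := ((strict_hz hU (hG i) hp).comp_tendsto hpv).trans_isBigO hO
    refine h1.congr_left fun s => ?_
    simp [γ, hG0, hv]
  have hev : ∀ᶠ s in 𝓝 (0:ℝ), γ s ∈ N ∧ K * ‖(0 : Fin m → ℝ) - (fun i => G i (γ s))‖ ≤ δ := by
    refine (hγ.eventually hN).and ?_
    have hc0 : Tendsto (fun s => K * ‖(0 : Fin m → ℝ) - (fun i => G i (γ s))‖) (𝓝 0) (𝓝 0) := by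
      have h1 : Tendsto (fun s => (fun i => G i (γ s))) (𝓝 0) (𝓝 (fun i => G i p)) :=
        (contAt_vec hU hp hG).tendsto.comp hγ
      have h2 : (fun i => G i p) = 0 := funext hG0
      rw [h2] at h1
      have h3 := ((tendsto_const_nhds (x := (0 : Fin m → ℝ))).sub h1).norm.const_mul K
      simpa using h3
    exact (hc0.eventually (gt_mem_nhds hδ)).mono fun s hs => hs.le
  have hch : ∀ s, ∃ a : Fin m → ℝ, (γ s ∈ N ∧ K * ‖(0 : Fin m → ℝ) - (fun i => G i (γ s))‖ ≤ δ) →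
      ‖a‖ ≤ K * ‖(0 : Fin m → ℝ) - (fun i => G i (γ s))‖ ∧ (fun i => G i (act W (γ s) a)) = 0 := by
    intro s
    by_cases hc : γ s ∈ N ∧ K * ‖(0 : Fin m → ℝ) - (fun i => G i (γ s))‖ ≤ δ
    · obtain ⟨a, ha⟩ := hsurj _ hc.1 0 hc.2
      exact ⟨a, fun _ => ha⟩
    · exact ⟨0, fun h => absurd h hc⟩
  choose a ha using hch
  have hao : a =o[𝓝 0] fun s : ℝ => s := by
    have : a =O[𝓝 0] fun s => (fun i => G i (γ s)) := by
      refine Asymptotics.IsBigO.of_bound K ?_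
      filter_upwards [hev] with s hs
      simpa using (ha s hs).1
    exact this.trans_isLittleO hGo
  have ha0 : Tendsto a (𝓝 0) (𝓝 0) := hao.trans_tendsto tendsto_id
  let Wc := LinearMap.toContinuousLinearMap W
  have hWao : (fun s => W (a s)) =o[𝓝 0] fun s : ℝ => s :=
    (Wc.isBigO_comp a (𝓝 0)).trans_isLittleO hao
  have hWa0 : Tendsto (fun s => W (a s)) (𝓝 0) (𝓝 0) := hWao.trans_tendsto tendsto_id
  have h1 := ((strict_hz hU hh hp).comp_tendsto (hγ.prodMk_nhds hWa0)).trans_isBigO hWao.isBigO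
  have h2 : (fun s => lD h p (W (a s))) =o[𝓝 0] fun s : ℝ => s :=
    ((LinearMap.toContinuousLinearMap (lD h p)).isBigO_comp (fun s => W (a s)) (𝓝 0)).trans_isLittleO
      hWao
  have h3 : (fun s => h (γ s)) =o[𝓝 0] fun s : ℝ => s := by
    have h4 := (h1.add h2).neg_left
    refine h4.congr' ?_ EventuallyEq.rfl
    have hU' : ∀ᶠ s in 𝓝 (0:ℝ), act W (γ s) (a s) ∈ U := by
      have := (tendsto_act W p).comp (hγ.prodMk_nhds ha0)
      exact this.eventually (hU.mem_nhds hp)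
    filter_upwards [hev, hU'] with s hs hs'
    have hz0 : h (act W (γ s) (a s)) = 0 := hGh _ hs' fun i => congrFun (ha s hs).2 i
    unfold act at hz0
    simp [hz0]
  have h5 := ((strict_hz hU hh hp).comp_tendsto hpv).trans_isBigO hO
  have h6 : (fun s : ℝ => s * lD h p v) =o[𝓝 0] fun s : ℝ => s := by
    refine (h3.sub h5).congr_left fun s => ?_
    simp [γ, hGh p hp hG0]
  by_contra hne
  have h7 := h6.def (show 0 < |lD h p v| / 2 by positivity)
  rw [Metric.eventually_nhds_iff_ball] at h7
  obtain ⟨r, hr, h7⟩ := h7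
  have h8 := h7 (r/2) (by simp [abs_of_pos hr]; linarith)
  rw [norm_mul, Real.norm_eq_abs, Real.norm_eq_abs, abs_of_pos (by positivity : (0:ℝ) < r/2)] at h8
  have : 0 < |lD h p v| := abs_pos.2 hne
  nlinarith

lemma coincide {m : ℕ} (hm : m ≤ n) {U : Set (Hpt n)} (hU : IsOpen U) {p : Hpt n} (hp : p ∈ U)
    {F G : Fin m → Hpt n → ℝ} (hF : ∀ i, IsC1H U (F i)) (hG : ∀ i, IsC1H U (G i))
    (hFl : LinearIndependent ℝ (fun i => gradH (F i) p))
    (hGl : LinearIndependent ℝ (fun i => gradH (G i) p)) (hG0 : ∀ i, G i p = 0)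
    (hGF : ∀ q ∈ U, (∀ i, G i q = 0) → ∀ i, F i q = 0) :
    ∃ V ∈ 𝓝 p, ∀ q ∈ V, (∀ i, F i q = 0) → ∀ i, G i q = 0 := by
  obtain ⟨W, hW, hl, N, hN, δ, hδ, K, hK, hinj, -⟩ := chart_F hm hU hp hF hFl
  let M : (Fin m → ℝ) →ₗ[ℝ] (Fin m → ℝ) := LinearMap.pi fun i => (lD (G i) p).comp W
  have hMi : Function.Injective M := by
    rw [← LinearMap.ker_eq_bot, LinearMap.ker_eq_bot']
    intro a ha
    ext i
    rw [← hl i a]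
    exact tangent hm hU hp hG hGl hG0 (hF i) (fun q hq h => hGF q hq h i)
      (fun i => congrFun ha i)
  let Me : (Fin m → ℝ) ≃L[ℝ] (Fin m → ℝ) := (LinearEquiv.ofInjectiveEndo M hMi).toContinuousLinearEquiv
  have hs : StrictA W p (fun q i => G i q) Me := strictA W hU hp hG
  obtain ⟨N', hN', δ', hδ', K', hK', -, hsurj⟩ := chart hW Me hs
  obtain ⟨r, hr, hact⟩ := act_nhds W (hU.mem_nhds hp)
  have hc0 : Tendsto (fun q => K' * ‖(0 : Fin m → ℝ) - (fun i => G i q)‖) (𝓝 p) (𝓝 0) := by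
    have h1 : Tendsto (fun q => (fun i => G i q)) (𝓝 p) (𝓝 (fun i => G i p)) :=
      (contAt_vec hU hp hG).tendsto
    have h2 : (fun i => G i p) = 0 := funext hG0
    rw [h2] at h1
    have h3 := ((tendsto_const_nhds (x := (0 : Fin m → ℝ))).sub h1).norm.const_mul K'
    simpa using h3
  have hmin : 0 < min (min δ δ') r := by positivity
  refine ⟨_, inter_mem (inter_mem hN hN') (inter_mem (Metric.ball_mem_nhds p hr)
    (hc0.eventually (gt_mem_nhds hmin))), ?_⟩
  rintro q ⟨⟨hqN, hqN'⟩, hqr, hqs⟩ hFq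
  simp only [mem_setOf_eq] at hqs
  obtain ⟨⟨h1, h2⟩, h3⟩ := And.imp_left lt_min_iff.1 (lt_min_iff.1 hqs)
  obtain ⟨a, ha, hGa⟩ := hsurj q hqN' 0 h2.le
  have hFa := hGF _ (hact q hqr a (ha.trans_lt h3)) (fun i => congrFun hGa i)
  have h4 := hinj q hqN a 0 (ha.trans h1.le) (by simpa using hδ.le)
  have h5 : ((fun i => F i (act W q a)) - fun i => F i (act W q 0)) = 0 := by
    ext i
    simp [hFa, act_zero, hFq]
  rw [h5, norm_zero, mul_zero, sub_zero] at h4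
  have ha0 : a = 0 := norm_le_zero_iff.1 h4
  rw [ha0, act_zero] at hGa
  exact fun i => congrFun hGa i

/-- Points with prescribed small value of the last function. -/
lemma approach {k : ℕ} (hk : k + 1 ≤ n) {U : Set (Hpt n)} (hU : IsOpen U) {p : Hpt n} (hp : p ∈ U)
    {F : Fin (k+1) → Hpt n → ℝ} (hF : ∀ i, IsC1H U (F i))
    (hli : LinearIndependent ℝ (fun i => gradH (F i) p)) (hF0 : ∀ i, F i p = 0)
    {V : Set (Hpt n)} (hV : V ∈ 𝓝 p) :
    ∃ δ > 0, ∀ τ : ℝ, |τ| < δ →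
      ∃ z ∈ V, (∀ i : Fin k, F i.castSucc z = 0) ∧ F (Fin.last k) z = τ := by
  obtain ⟨W, hW, hl, N, hN, δ, hδ, K, hK, -, hsurj⟩ := chart_F hk hU hp hF hli
  obtain ⟨r, hr, hact⟩ := act_nhds W hV
  have h0 : (fun i => F i p) = 0 := funext hF0
  refine ⟨min δ r / K, by positivity, fun τ hτ => ?_⟩
  have hn : ‖(Pi.single (Fin.last k) τ : Fin (k+1) → ℝ) - (fun i => F i p)‖ = |τ| := by
    rw [h0, sub_zero, Pi.norm_single, Real.norm_eq_abs]
  have h1 : K * |τ| < min δ r := by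
    rwa [lt_div_iff₀ hK, mul_comm] at hτ
  obtain ⟨h2, h3⟩ := lt_min_iff.1 h1
  obtain ⟨a, ha, hFa⟩ := hsurj p (mem_of_mem_nhds hN) (Pi.single (Fin.last k) τ)
    (by rw [hn]; exact h2.le)
  rw [hn] at ha
  refine ⟨act W p a, hact p (Metric.mem_ball_self hr) a (ha.trans_lt h3), fun i => ?_, ?_⟩
  · rw [congrFun hFa i.castSucc]
    simp [Pi.single_apply, Fin.ext_iff]
    intro h
    omega
  · rw [congrFun hFa (Fin.last k)]
    simp

/-- Small neighbourhoods in which the two halves are connected. -/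
lemma halves {k : ℕ} (hk : k + 1 ≤ n) {U : Set (Hpt n)} (hU : IsOpen U) {p : Hpt n} (hp : p ∈ U)
    {F : Fin (k+1) → Hpt n → ℝ} (hF : ∀ i, IsC1H U (F i))
    (hli : LinearIndependent ℝ (fun i => gradH (F i) p)) (hF0 : ∀ i, F i p = 0) :
    ∃ V, IsOpen V ∧ p ∈ V ∧ V ⊆ U ∧ ∃ ε > 0, (∀ q ∈ V, |F (Fin.last k) q| < ε) ∧
      ∀ I : Set ℝ, I ⊆ Ioo (-ε) ε → IsPreconnected I →
        IsPreconnected {q ∈ V | (∀ i : Fin k, F i.castSucc q = 0) ∧ F (Fin.last k) q ∈ I} := by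
  obtain ⟨W, hW, hl, N, hN, δ, hδ, K, hK, hinj, hsurj⟩ := chart_F hk hU hp hF hli
  obtain ⟨r, hr, hact⟩ := act_nhds W (hU.mem_nhds hp)
  set δ' := min δ r with hδ'
  have hδ'0 : 0 < δ' := by positivity
  have h0 : (fun i => F i p) = 0 := funext hF0
  have hc0 : Tendsto (fun q => ‖(fun i => F i q)‖) (𝓝 p) (𝓝 0) := by
    have h1 : Tendsto (fun q => (fun i => F i q)) (𝓝 p) (𝓝 (fun i => F i p)) :=
      (contAt_vec hU hp hF).tendsto
    rw [h0] at h1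
    simpa using h1.norm
  set ε := δ' / (2 * K) with hε
  have hε0 : 0 < ε := by positivity
  have hev : ∀ᶠ q in 𝓝 p, ‖(fun i => F i q)‖ < ε := hc0.eventually (gt_mem_nhds hε0)
  obtain ⟨ρ, hρ, hball⟩ := Metric.mem_nhds_iff.1 (inter_mem hN (inter_mem
    (Metric.ball_mem_nhds p hr) hev))
  set B := Metric.ball p ρ with hB
  have hBN : ∀ q ∈ B, q ∈ N := fun q hq => (hball hq).1
  have hBr : ∀ q ∈ B, q ∈ Metric.ball p r := fun q hq => (hball hq).2.1
  have hBε : ∀ q ∈ B, ‖(fun i => F i q)‖ < ε := fun q hq => (hball hq).2.2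
  let T : Set (Hpt n) := ⋃ a ∈ {a : Fin (k+1) → ℝ | ‖a‖ < δ'}, (fun z => act W z (-a)) ⁻¹' B
  have hT : IsOpen T := by
    refine isOpen_biUnion fun a _ => Metric.isOpen_ball.preimage ?_
    exact (continuous_act W).comp (continuous_id.prodMk continuous_const)
  have hTm : ∀ z, z ∈ T ↔ ∃ q ∈ B, ∃ a : Fin (k+1) → ℝ, ‖a‖ < δ' ∧ z = act W q a := by
    intro z
    simp only [T, mem_iUnion, mem_setOf_eq, mem_preimage, exists_prop]
    constructor
    · rintro ⟨a, ha, hz⟩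
      refine ⟨_, hz, a, ha, ?_⟩
      rw [act_add hW, neg_add_cancel, act_zero]
    · rintro ⟨q, hq, a, ha, rfl⟩
      refine ⟨a, ha, ?_⟩
      rwa [act_add hW, add_neg_cancel, act_zero]
  have hTU : T ⊆ U := by
    intro z hz
    obtain ⟨q, hq, a, ha, rfl⟩ := (hTm z).1 hz
    exact hact q (hBr q hq) a (ha.trans_le (min_le_right _ _))
  have hV : IsOpen (T ∩ (F (Fin.last k)) ⁻¹' Ioo (-ε) ε) :=
    ((hF (Fin.last k)).contOn.mono hTU).isOpen_inter_preimage hT isOpen_Ioo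
  have hpB : p ∈ B := Metric.mem_ball_self hρ
  refine ⟨_, hV, ⟨(hTm p).2 ⟨p, hpB, 0, by simpa using hδ'0, (act_zero W p).symm⟩, ?_⟩,
    fun z hz => hTU hz.1, ε, hε0, fun q hq => abs_lt.2 hq.2, ?_⟩
  · simp [hF0, hε0]
  intro I hI hIc
  let c : ℝ → Fin (k+1) → ℝ := fun τ => Pi.single (Fin.last k) τ
  have hcn : ∀ τ, ‖c τ‖ = |τ| := fun τ => by
    simp only [c]; rw [Pi.norm_single, Real.norm_eq_abs]
  have hcc : Continuous c := by
    simp only [c]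
    exact continuous_pi fun i => by
      by_cases hi : i = Fin.last k
      · subst hi; simpa using continuous_id'
      · simpa [Pi.single_apply, hi] using continuous_const
  have hcs : ∀ τ (i : Fin k), c τ i.castSucc = 0 := by
    intro τ i
    simp [c, Pi.single_apply, Fin.ext_iff]
    intro h
    omega
  have hcl : ∀ τ, c τ (Fin.last k) = τ := by
    intro τ; simp [c]
  have hsm : ∀ q ∈ B, ∀ τ ∈ I, K * ‖c τ - (fun i => F i q)‖ < δ' := by
    intro q hq τ hτ
    have h1 := norm_sub_le (c τ) (fun i => F i q)
    have h2 := hBε q hq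
    have h3 : |τ| < ε := abs_lt.2 (hI hτ)
    rw [hcn] at h1
    have h4 : ‖c τ - (fun i => F i q)‖ < 2 * ε := by linarith
    calc K * ‖c τ - (fun i => F i q)‖ < K * (2 * ε) := by gcongr
      _ = δ' := by rw [hε]; field_simp
  have hch : ∀ z : Hpt n × ℝ, ∃ a : Fin (k+1) → ℝ, z ∈ B ×ˢ I →
      ‖a‖ < δ' ∧ (fun i => F i (act W z.1 a)) = c z.2 := by
    rintro ⟨q, τ⟩
    by_cases hz : (q, τ) ∈ B ×ˢ I
    · have h1 := hsm q hz.1 τ hz.2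
      obtain ⟨a, ha, hFa⟩ := hsurj q (hBN q hz.1) (c τ) (h1.le.trans (min_le_left _ _))
      exact ⟨a, fun _ => ⟨ha.trans_lt h1, hFa⟩⟩
    · exact ⟨0, fun h => absurd h hz⟩
  choose a ha using hch
  have hac : ContinuousOn a (B ×ˢ I) := by
    intro z0 hz0
    rw [ContinuousWithinAt, tendsto_iff_norm_sub_tendsto_zero]
    have hup : Tendsto (fun z : Hpt n × ℝ => K * ‖c z.2 - (fun i => F i (act W z.1 (a z0)))‖)
        (𝓝[B ×ˢ I] z0) (𝓝 0) := by
      have hUz : act W z0.1 (a z0) ∈ U :=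
        hact _ (hBr _ hz0.1) _ ((ha z0 hz0).1.trans_le (min_le_right _ _))
      have hc1 : Continuous (fun z : Hpt n × ℝ => act W z.1 (a z0)) :=
        (continuous_act W).comp (continuous_fst.prodMk continuous_const)
      have h1 : Tendsto (fun z : Hpt n × ℝ => (fun i => F i (act W z.1 (a z0)))) (𝓝 z0)
          (𝓝 (fun i => F i (act W z0.1 (a z0)))) :=
        (contAt_vec hU hUz hF).tendsto.comp (hc1.tendsto z0)
      rw [(ha z0 hz0).2] at h1
      have h2 := ((((hcc.comp continuous_snd).tendsto z0).sub h1).norm.const_mul K)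
      simp only [Function.comp, sub_self, norm_zero, mul_zero] at h2
      exact h2.mono_left nhdsWithin_le_nhds
    refine squeeze_zero' (Eventually.of_forall fun _ => norm_nonneg _) ?_ hup
    filter_upwards [self_mem_nhdsWithin] with z hz
    have h3 := hinj z.1 (hBN _ hz.1) (a z) (a z0) ((ha z hz).1.le.trans (min_le_left _ _))
      ((ha z0 hz0).1.le.trans (min_le_left _ _))
    rwa [(ha z hz).2] at h3
  have hpre : IsPreconnected (B ×ˢ I) := by
    exact (convex_ball p ρ).isPreconnected.prod hIc
  have himg := hpre.image (fun z => act W z.1 (a z))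
    ((continuous_act W).comp_continuousOn (continuousOn_fst.prodMk hac))
  convert himg using 1
  ext z
  constructor
  · rintro ⟨⟨hzT, hzε⟩, hz0, hzI⟩
    obtain ⟨q, hq, b, hb, rfl⟩ := (hTm z).1 hzT
    refine ⟨(q, F (Fin.last k) (act W q b)), ⟨hq, hzI⟩, ?_⟩
    have hm := ha (q, F (Fin.last k) (act W q b)) ⟨hq, hzI⟩
    have h3 := hinj q (hBN _ hq) (a (q, F (Fin.last k) (act W q b))) b
      (hm.1.le.trans (min_le_left _ _)) (hb.le.trans (min_le_left _ _))
    have h4 : (fun i => F i (act W q b)) = c (F (Fin.last k) (act W q b)) := by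
      ext i
      refine Fin.lastCases ?_ (fun i => ?_) i
      · rw [hcl]
      · rw [hcs, hz0]
    simp only at hm
    rw [hm.2, h4, sub_self, norm_zero, mul_zero] at h3
    have h5 := sub_eq_zero.1 (norm_le_zero_iff.1 h3)
    simp only
    rw [h5]
  · rintro ⟨⟨q, τ⟩, hz, rfl⟩
    have hm := ha (q, τ) hz
    have hlast : F (Fin.last k) (act W q (a (q, τ))) = τ := by
      have := congrFun hm.2 (Fin.last k)
      simpa [hcl] using this
    have hrest : ∀ i : Fin k, F i.castSucc (act W q (a (q, τ))) = 0 := by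
      intro i
      have := congrFun hm.2 i.castSucc
      simpa [hcs] using this
    refine ⟨⟨(hTm _).2 ⟨q, hz.1, _, hm.1, rfl⟩, ?_⟩, hrest, ?_⟩
    · change F (Fin.last k) (act W q (a (q, τ))) ∈ Ioo (-ε) ε
      rw [hlast]
      exact hI hz.2
    · change F (Fin.last k) (act W q (a (q, τ))) ∈ I
      rw [hlast]
      exact hz.2


/-! ## Part 6: the main theorem -/

lemma IsC1H.mono {U V : Set (Hpt n)} {f : Hpt n → ℝ} (hf : IsC1H U f) (h : V ⊆ U) : IsC1H V f :=
  ⟨hf.contOn.mono h, fun p hp => hf.ldiff p (h hp), fun j => (hf.contGrad j).mono h⟩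

lemma gradH_neg (f : Hpt n → ℝ) (p : Hpt n) : gradH (fun q => -f q) p = -gradH f p := by
  funext j
  simp only [gradH, lineDeriv, Pi.neg_apply]
  exact deriv.fun_neg

lemma IsC1H.neg {U : Set (Hpt n)} {f : Hpt n → ℝ} (hf : IsC1H U f) :
    IsC1H U (fun q => -f q) := by
  refine ⟨hf.contOn.neg, fun p hp j => ?_, fun j => ?_⟩
  · have := hf.ldiff p hp j
    unfold LineDifferentiableAt at this ⊢
    exact this.neg
  · simp only [gradH_neg]
    exact (hf.contGrad j).neg

lemma contGradAt {U : Set (Hpt n)} (hU : IsOpen U) {f : Hpt n → ℝ} (hf : IsC1H U f) {p : Hpt n}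
    (hp : p ∈ U) : ContinuousAt (gradH f) p :=
  continuousAt_pi.2 fun j => (hf.contGrad j).continuousAt (hU.mem_nhds hp)

lemma li_nhds {m : ℕ} {U : Set (Hpt n)} (hU : IsOpen U) {f : Fin m → Hpt n → ℝ}
    (hf : ∀ i, IsC1H U (f i)) {p : Hpt n} (hp : p ∈ U)
    (hl : LinearIndependent ℝ (fun i => gradH (f i) p)) :
    ∀ᶠ q in 𝓝 p, LinearIndependent ℝ (fun i => gradH (f i) q) := by
  have hc : ContinuousAt (fun q => fun i => gradH (f i) q) p :=
    continuousAt_pi.2 fun i => contGradAt hU (hf i) hp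
  have ho : IsOpen {v : Fin m → (Fin (2*n) → ℝ) | LinearIndependent ℝ v} :=
    isOpen_setOfPred_linearIndependent
  exact hc.eventually (ho.mem_nhds hl)

lemma pick {k : ℕ} {V : Type*} [AddCommGroup V] [Module ℝ V] (v : Fin k → V) (w : Fin (k+1) → V)
    (hv : LinearIndependent ℝ v) (hw : LinearIndependent ℝ w) :
    ∃ j, LinearIndependent ℝ (Fin.snoc v (w j) : Fin (k+1) → V) := by
  by_contra hcon
  push Not at hcon
  have h1 : ∀ j, w j ∈ Submodule.span ℝ (range v) := by
    intro j
    by_contra hj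
    exact hcon j (linearIndependent_finSnoc.2 ⟨hv, hj⟩)
  have h2 : Submodule.span ℝ (range w) ≤ Submodule.span ℝ (range v) :=
    Submodule.span_le.2 (by rintro _ ⟨j, rfl⟩; exact h1 j)
  have : FiniteDimensional ℝ (Submodule.span ℝ (range v)) :=
    FiniteDimensional.span_of_finite ℝ (finite_range v)
  have h3 := Submodule.finrank_mono h2
  rw [finrank_span_eq_card hw, finrank_span_eq_card hv] at h3
  simp at h3

/-- closure of `S` in a boundary frame -/
lemma frame_closure {k : ℕ} {S : Set (Hpt n)} {p : Hpt n} {U : Set (Hpt n)}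
    {f : Fin (k+1) → Hpt n → ℝ} (h : IsBdryFrame k S p U f) {q : Hpt n} (hq : q ∈ U)
    (hqS : q ∈ closure S) : (∀ i : Fin k, f i.castSucc q = 0) ∧ 0 ≤ f (Fin.last k) q := by
  obtain ⟨hU, hp, hf, hli, hUS, hfp⟩ := h
  have hc : ∀ i, ContinuousAt (f i) q := fun i => (hf i).contOn.continuousAt (hU.mem_nhds hq)
  have hfr : ∃ᶠ z in 𝓝 q, z ∈ S := mem_closure_iff_frequently.1 hqS
  have hfr2 : ∃ᶠ z in 𝓝 q, (∀ i : Fin k, f i.castSucc z = 0) ∧ 0 < f (Fin.last k) z := by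
    refine (hfr.and_eventually (hU.mem_nhds hq)).mono ?_
    rintro z ⟨hz1, hz2⟩
    have : z ∈ U ∩ S := ⟨hz2, hz1⟩
    rw [hUS] at this
    exact this.2
  refine ⟨fun i => ?_, ?_⟩
  · by_contra hne
    have := (hc i.castSucc).eventually (isOpen_compl_singleton.mem_nhds hne)
    obtain ⟨z, hz1, hz2⟩ := (hfr2.and_eventually this).exists
    exact hz2 (hz1.1 i)
  · by_contra hne
    push Not at hne
    have := (hc (Fin.last k)).eventually (gt_mem_nhds hne)
    obtain ⟨z, hz1, hz2⟩ := (hfr2.and_eventually this).exists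
    linarith [hz1.2]

lemma dir_two {k : ℕ} (hn : 1 ≤ n) (D : HomDist n) (hk : k + 1 ≤ n) {O S : Set (Hpt n)}
    (hO : IsOpen O)
    (hfr : ∀ p ∈ O ∩ bdry S, ∃ (U : Set (Hpt n)) (f : Fin (k+1) → Hpt n → ℝ),
          IsBdryFrame k S p U f) :
    IsC1HCodim (k+1) (O ∩ bdry S) ∧
    ∀ p ∈ O ∩ bdry S, ∃ U : Set (Hpt n), IsOpen U ∧ p ∈ U ∧
      ∃ S' : Set (Hpt n), S' ⊆ U ∧ IsC1HCodim k S' ∧ U ∩ closure S ⊆ S' ∧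
        ∀ r : ℝ, 0 < r → (hball D p r ∩ (S' \ closure S)).Nonempty := by
  constructor
  · intro p hp
    obtain ⟨U, f, hF⟩ := hfr p hp
    have hF' := hF
    obtain ⟨hU, hpU, hf, hli, hUS, hfp⟩ := hF'
    refine ⟨U ∩ O, hU.inter hO, ⟨hpU, hp.1⟩, f, fun i => (hf i).mono inter_subset_left,
      fun q hq => hli q hq.1, ?_⟩
    ext q
    constructor
    · rintro ⟨⟨hqO, hqc, hqS⟩, hqU, -⟩
      obtain ⟨h1, h2⟩ := frame_closure hF hqU hqc
      refine ⟨⟨hqU, hqO⟩, fun i => ?_⟩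
      refine Fin.lastCases ?_ h1 i
      by_contra hne
      have : q ∈ U ∩ S := by
        rw [hUS]
        exact ⟨hqU, h1, lt_of_le_of_ne h2 (Ne.symm hne)⟩
      exact hqS this.2
    · rintro ⟨⟨hqU, hqO⟩, h0⟩
      refine ⟨⟨hqO, ?_, ?_⟩, hqU, hqO⟩
      · rw [mem_closure_iff_nhds]
        intro V hV
        obtain ⟨δ, hδ, h⟩ := approach hk hU hqU hf (hli q hqU) h0 (inter_mem hV (hU.mem_nhds hqU))
        obtain ⟨z, hz, hz1, hz2⟩ := h (δ/2) (by rw [abs_of_pos (by positivity)]; linarith)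
        have : z ∈ U ∩ S := by
          rw [hUS]
          exact ⟨hz.2, hz1, by rw [hz2]; positivity⟩
        exact ⟨z, hz.1, this.2⟩
      · intro hqS
        have : q ∈ U ∩ S := ⟨hqU, hqS⟩
        rw [hUS] at this
        have h2 := this.2.2
        rw [h0] at h2
        exact lt_irrefl _ h2
  · intro p hp
    obtain ⟨U, f, hF⟩ := hfr p hp
    have hF' := hF
    obtain ⟨hU, hpU, hf, hli, hUS, hfp⟩ := hF'
    refine ⟨U, hU, hpU, {q ∈ U | ∀ i : Fin k, f i.castSucc q = 0}, fun q hq => hq.1, ?_, ?_, ?_⟩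
    · intro q hq
      refine ⟨U, hU, hq.1, fun i => f i.castSucc, fun i => hf _, fun z hz => ?_, ?_⟩
      · exact (hli z hz).comp _ (Fin.castSucc_injective k)
      · exact inter_eq_left.2 fun z hz => hz.1
    · rintro q ⟨hq1, hq2⟩
      exact ⟨hq1, (frame_closure hF hq1 hq2).1⟩
    · intro r hr
      have h0 : ∀ i, f i p = 0 := fun i =>
        Fin.lastCases (motive := fun i => f i p = 0) hfp (frame_closure hF hpU hp.2.1).1 i
      obtain ⟨δ, hδ, h⟩ := approach hk hU hpU hf (hli p hpU) h0
        (inter_mem (hball_nhds D hn p hr) (hU.mem_nhds hpU))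
      obtain ⟨z, hz, hz1, hz2⟩ := h (-(δ/2)) (by rw [abs_neg, abs_of_pos (by positivity)]; linarith)
      refine ⟨z, hz.1, ⟨hz.2, hz1⟩, fun hzc => ?_⟩
      have := (frame_closure hF hz.2 hzc).2
      rw [hz2] at this
      linarith

lemma dir_one {k : ℕ} (hn : 1 ≤ n) (D : HomDist n) (hk : k + 1 ≤ n) {O S : Set (Hpt n)}
    (hO : IsOpen O) (hS : IsC1HCodim k S)
    (hB : IsC1HCodim (k+1) (O ∩ bdry S)) {p : Hpt n} (hp : p ∈ O ∩ bdry S)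
    (h3 : ∃ U : Set (Hpt n), IsOpen U ∧ p ∈ U ∧
      ∃ S' : Set (Hpt n), S' ⊆ U ∧ IsC1HCodim k S' ∧ U ∩ closure S ⊆ S' ∧
        ∀ r : ℝ, 0 < r → (hball D p r ∩ (S' \ closure S)).Nonempty) :
    ∃ (U : Set (Hpt n)) (f : Fin (k+1) → Hpt n → ℝ), IsBdryFrame k S p U f := by
  obtain ⟨U1, hU1, hpU1, S', hS'U, hS', hcS', hout⟩ := h3
  obtain ⟨U2, hU2, hpU2, f, hf, hfl, hfS'⟩ := hS' p (hcS' ⟨hpU1, hp.2.1⟩)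
  obtain ⟨U3, hU3, hpU3, g, hg, hgl, hgB⟩ := hB p hp
  obtain ⟨j, hj⟩ := pick _ _ (hfl p hpU2) (hgl p hpU3)
  set F : Fin (k+1) → Hpt n → ℝ := Fin.snoc f (g j) with hFdef
  have hFc : ∀ i : Fin k, F i.castSucc = f i := fun i => by simp [F]
  have hFl : F (Fin.last k) = g j := by simp [F]
  have hgrad : ∀ q, (fun i => gradH (F i) q) =
      (Fin.snoc (fun i => gradH (f i) q) (gradH (g j) q) : Fin (k+1) → Fin (2*n) → ℝ) := by
    intro q
    funext i
    refine Fin.lastCases ?_ (fun i => ?_) i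
    · simp [hFl]
    · simp [hFc]
  set U4 : Set (Hpt n) := ((U1 ∩ U2) ∩ U3) ∩ O with hU4def
  have hU4 : IsOpen U4 := ((hU1.inter hU2).inter hU3).inter hO
  have hpU4 : p ∈ U4 := ⟨⟨⟨hpU1, hpU2⟩, hpU3⟩, hp.1⟩
  have hF : ∀ i, IsC1H U4 (F i) := by
    intro i
    refine Fin.lastCases ?_ (fun i => ?_) i
    · rw [hFl]; exact (hg j).mono fun q hq => hq.1.2
    · rw [hFc]; exact (hf i).mono fun q hq => hq.1.1.2
  have hFlip : LinearIndependent ℝ (fun i => gradH (F i) p) := by rw [hgrad]; exact hj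
  -- on U4, closure S is contained in f = 0
  have hcl : ∀ q ∈ U4, q ∈ closure S → ∀ i : Fin k, F i.castSucc q = 0 := by
    intro q hq hqc i
    have : q ∈ S' ∩ U2 := ⟨hcS' ⟨hq.1.1.1, hqc⟩, hq.1.1.2⟩
    rw [hfS'] at this
    rw [hFc]; exact this.2 i
  have hbg : ∀ q ∈ U4, q ∈ bdry S ↔ ∀ i, g i q = 0 := by
    intro q hq
    constructor
    · intro h
      have : q ∈ (O ∩ bdry S) ∩ U3 := ⟨⟨hq.2, h⟩, hq.1.2⟩
      rw [hgB] at this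
      exact this.2
    · intro h
      have : q ∈ {q ∈ U3 | ∀ i, g i q = 0} := ⟨hq.1.2, h⟩
      rw [← hgB] at this
      exact this.1.2
  have hGF : ∀ q ∈ U4, (∀ i, g i q = 0) → ∀ i, F i q = 0 := by
    intro q hq h i
    refine Fin.lastCases ?_ (fun i => ?_) i
    · rw [hFl]; exact h j
    · exact hcl q hq ((hbg q hq).2 h).1 i
  obtain ⟨V1, hV1, hco⟩ := coincide hk hU4 hpU4 hF (fun i => (hg i).mono fun q hq => hq.1.2)
    hFlip (hgl p hpU3) ((hbg p hpU4).1 hp.2) hGF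
  have hnb : (U4 ∩ V1) ∩ {q | LinearIndependent ℝ (fun i => gradH (F i) q)} ∈ 𝓝 p :=
    inter_mem (inter_mem (hU4.mem_nhds hpU4) hV1) (li_nhds hU4 hF hpU4 hFlip)
  obtain ⟨U5, hU5s, hU5, hpU5⟩ := mem_nhds_iff.1 hnb
  have hU54 : U5 ⊆ U4 := fun q hq => (hU5s hq).1.1
  have hF0 : ∀ i, F i p = 0 := hGF p hpU4 ((hbg p hpU4).1 hp.2)
  obtain ⟨V, hV, hpV, hVU, ε, hε, hVε, hhalf⟩ := halves hk hU5 hpU5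
    (fun i => (hF i).mono hU54) hFlip hF0
  have hV4 : V ⊆ U4 := hVU.trans hU54
  have hbF : ∀ q ∈ V, (∀ i, F i q = 0) → q ∈ bdry S := fun q hq h =>
    (hbg q (hV4 hq)).2 (hco q (hU5s (hVU hq)).1.2 h)
  have hbF' : ∀ q ∈ V, q ∈ bdry S → ∀ i, F i q = 0 := fun q hq h =>
    hGF q (hV4 hq) ((hbg q (hV4 hq)).1 h)
  have hsnoc : ∀ q, (∀ i : Fin k, F i.castSucc q = 0) → F (Fin.last k) q = 0 → ∀ i, F i q = 0 :=
    fun q h1 h2 i => Fin.lastCases (motive := fun i => F i q = 0) h2 h1 i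
  -- S avoids F_last = 0
  have hSne : ∀ q ∈ V, q ∈ S → F (Fin.last k) q ≠ 0 := fun q hq hqS h0 =>
    (hbF q hq (hsnoc q (hcl q (hV4 hq) (subset_closure hqS)) h0)).2 hqS
  -- S is relatively open in f = 0
  have hopen : ∀ q ∈ V ∩ S, ∃ N, IsOpen N ∧ q ∈ N ∧
      ∀ z ∈ N, (∀ i : Fin k, F i.castSucc z = 0) → z ∈ S := by
    rintro q ⟨hqV, hqS⟩
    obtain ⟨U6, hU6, hqU6, h, hh, hhl, hhS⟩ := hS q hqS
    have hh0 : ∀ z ∈ U6, z ∈ S ↔ ∀ i, h i z = 0 := by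
      intro z hz
      have := Set.ext_iff.1 hhS z
      simpa [hz] using this
    obtain ⟨N, hN, hNc⟩ := coincide (m := k) (by omega) (hV.inter hU6) (p := q) ⟨hqV, hqU6⟩
      (F := fun i => F i.castSucc) (G := h)
      (fun i => (hF _).mono fun z hz => hV4 hz.1) (fun i => (hh i).mono inter_subset_right)
      ((hU5s (hVU hqV)).2.comp _ (Fin.castSucc_injective k)) (hhl q hqU6) ((hh0 q hqU6).1 hqS)
      (fun z hz h0 i => hcl z (hV4 hz.1) (subset_closure ((hh0 z hz.2).2 h0)) i)
    obtain ⟨N', hN's, hN', hqN'⟩ := mem_nhds_iff.1 (inter_mem hN (hU6.mem_nhds hqU6))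
    exact ⟨N', hN', hqN', fun z hz hz0 => (hh0 z (hN's hz).2).2 (hNc z (hN's hz).1 hz0)⟩
  choose! N hNo hqN hNS using hopen
  -- dichotomy on halves
  have hdich : ∀ I ⊆ Ioo (-ε) ε, IsPreconnected I → (0:ℝ) ∉ I →
      (∀ q ∈ V, (∀ i : Fin k, F i.castSucc q = 0) → F (Fin.last k) q ∈ I → q ∈ S) ∨
      (∀ q ∈ V, (∀ i : Fin k, F i.castSucc q = 0) → F (Fin.last k) q ∈ I → q ∉ S) := by
    intro I hI hIc hI0
    have hpc := hhalf I hI hIc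
    rw [or_iff_not_imp_right]
    intro hex
    push Not at hex
    obtain ⟨q0, hq0V, hq0f, hq0I, hq0S⟩ := hex
    intro q hqV hqf hqI
    by_contra hqS
    -- a point of `closure S` in the half lies in `S`
    have hrel : ∀ z ∈ V, (∀ i : Fin k, F i.castSucc z = 0) → F (Fin.last k) z ∈ I →
        z ∈ closure S → z ∈ S := by
      intro z hzV _ hzI hzc
      by_contra hzS
      have h0 := hbF' z hzV ⟨hzc, hzS⟩ (Fin.last k)
      rw [h0] at hzI
      exact hI0 hzI
    obtain ⟨z, ⟨hzV, hzf, hzI⟩, hzN, hzc⟩ := hpc (⋃ q ∈ V ∩ S, N q) (closure S)ᶜ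
      (isOpen_biUnion fun q hq => hNo q hq) isClosed_closure.isOpen_compl
      (by
        rintro z ⟨hzV, hzf, hzI⟩
        by_cases hzc : z ∈ closure S
        · have hzVS : z ∈ V ∩ S := ⟨hzV, hrel z hzV hzf hzI hzc⟩
          exact Or.inl (mem_biUnion hzVS (hqN z hzVS))
        · exact Or.inr hzc)
      ⟨q0, ⟨hq0V, hq0f, hq0I⟩, mem_biUnion (show q0 ∈ V ∩ S from ⟨hq0V, hq0S⟩)
        (hqN q0 ⟨hq0V, hq0S⟩)⟩
      ⟨q, ⟨hqV, hqf, hqI⟩, fun hqc => hqS (hrel q hqV hqf hqI hqc)⟩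
    obtain ⟨w, hw, hzw⟩ := mem_iUnion₂.1 hzN
    exact hzc (subset_closure (hNS w hw z hzw hzf))
  have hI1 := hdich (Ioo 0 ε) (Ioo_subset_Ioo_left (by linarith)) isPreconnected_Ioo (by simp)
  have hI2 := hdich (Ioo (-ε) 0) (Ioo_subset_Ioo_right hε.le) isPreconnected_Ioo (by simp)
  -- existence of an outside point
  obtain ⟨r, hr, hrV⟩ := exists_hball_subset D hn p (hV.mem_nhds hpV)
  obtain ⟨z, hzr, hzS', hzc⟩ := hout r hr
  have hzV : z ∈ V := hrV hzr
  have hz0 : ∀ i : Fin k, F i.castSucc z = 0 := by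
    have : z ∈ S' ∩ U2 := ⟨hzS', (hV4 hzV).1.1.2⟩
    rw [hfS'] at this
    intro i; rw [hFc]; exact this.2 i
  have hznS : z ∉ S := fun h => hzc (subset_closure h)
  have hzl : F (Fin.last k) z ≠ 0 := fun h => hzc (hbF z hzV (hsnoc z hz0 h)).1
  -- existence of an inside point
  obtain ⟨y, hyV, hyS⟩ := mem_closure_iff_nhds.1 hp.2.1 V (hV.mem_nhds hpV)
  have hy0 := hcl y (hV4 hyV) (subset_closure hyS)
  have hyl := hSne y hyV hyS
  have hab : ∀ q ∈ V, 0 < F (Fin.last k) q → F (Fin.last k) q ∈ Ioo 0 ε := fun q hq h =>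
    ⟨h, (abs_lt.1 (hVε q hq)).2⟩
  have hab' : ∀ q ∈ V, F (Fin.last k) q < 0 → F (Fin.last k) q ∈ Ioo (-ε) 0 := fun q hq h =>
    ⟨(abs_lt.1 (hVε q hq)).1, h⟩
  have hliV : ∀ q ∈ V, LinearIndependent ℝ (fun i => gradH (F i) q) := fun q hq =>
    (hU5s (hVU hq)).2
  have key : ((∀ q ∈ V, (∀ i : Fin k, F i.castSucc q = 0) → 0 < F (Fin.last k) q → q ∈ S) ∧
      (∀ q ∈ V, (∀ i : Fin k, F i.castSucc q = 0) → F (Fin.last k) q < 0 → q ∉ S)) ∨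
      ((∀ q ∈ V, (∀ i : Fin k, F i.castSucc q = 0) → 0 < F (Fin.last k) q → q ∉ S) ∧
      (∀ q ∈ V, (∀ i : Fin k, F i.castSucc q = 0) → F (Fin.last k) q < 0 → q ∈ S)) := by
    rcases hI1 with hI1 | hI1 <;> rcases hI2 with hI2 | hI2
    · exfalso
      rcases lt_or_gt_of_ne hzl with h | h
      · exact hznS (hI2 z hzV hz0 (hab' z hzV h))
      · exact hznS (hI1 z hzV hz0 (hab z hzV h))
    · exact Or.inl ⟨fun q hq h h' => hI1 q hq h (hab q hq h'),
        fun q hq h h' => hI2 q hq h (hab' q hq h')⟩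
    · exact Or.inr ⟨fun q hq h h' => hI1 q hq h (hab q hq h'),
        fun q hq h h' => hI2 q hq h (hab' q hq h')⟩
    · exfalso
      rcases lt_or_gt_of_ne hyl with h | h
      · exact hI2 y hyV hy0 (hab' y hyV h) hyS
      · exact hI1 y hyV hy0 (hab y hyV h) hyS
  rcases key with ⟨ha, hb⟩ | ⟨ha, hb⟩
  · refine ⟨V, F, hV, hpV, fun i => (hF i).mono hV4, hliV, ?_, hF0 _⟩
    ext q
    constructor
    · rintro ⟨hqV, hqS⟩
      have h0 := hcl q (hV4 hqV) (subset_closure hqS)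
      refine ⟨hqV, h0, ?_⟩
      rcases lt_or_gt_of_ne (hSne q hqV hqS) with h | h
      · exact absurd hqS (hb q hqV h0 h)
      · exact h
    · rintro ⟨hqV, h0, h⟩
      exact ⟨hqV, ha q hqV h0 h⟩
  · set F' : Fin (k+1) → Hpt n → ℝ := Fin.snoc f (fun q => -g j q) with hF'def
    have hFc' : ∀ i : Fin k, F' i.castSucc = f i := fun i => by simp [F']
    have hFl' : ∀ q, F' (Fin.last k) q = - F (Fin.last k) q := fun q => by simp [F', F]
    have hFcc : ∀ i : Fin k, F' i.castSucc = F i.castSucc := fun i => by rw [hFc, hFc']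
    refine ⟨V, F', hV, hpV, fun i => ?_, fun q hq => ?_, ?_, by rw [hFl', hF0]; simp⟩
    · refine Fin.lastCases ?_ (fun i => ?_) i
      · have : F' (Fin.last k) = fun q => - F (Fin.last k) q := funext hFl'
        rw [this]
        exact ((hF _).mono hV4).neg
      · rw [hFcc]; exact (hF _).mono hV4
    · have h1 := hliV q hq
      have h2 := h1.units_smul (Fin.snoc (fun _ : Fin k => (1 : ℝˣ)) (-1) : Fin (k+1) → ℝˣ)
      convert h2 using 1
      funext i
      refine Fin.lastCases ?_ (fun i => ?_) i
      · have : F' (Fin.last k) = fun q => - F (Fin.last k) q := funext hFl'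
        rw [this, gradH_neg]
        simp
      · rw [hFcc]; simp
    · ext q
      simp only [mem_inter_iff, hFl', hFcc]
      constructor
      · rintro ⟨hqV, hqS⟩
        have h0 := hcl q (hV4 hqV) (subset_closure hqS)
        refine ⟨hqV, h0, ?_⟩
        rcases lt_or_gt_of_ne (hSne q hqV hqS) with h | h
        · linarith
        · exact absurd hqS (ha q hqV h0 h)
      · rintro ⟨hqV, h0, h⟩
        exact ⟨hqV, hb q hqV h0 (by linarith)⟩
/-- **Characterization of submanifolds with boundary in non-critical low codimension**
(Theorem 3.2): for `1 ≤ k ≤ n−1`, `O ⊆ ℍⁿ` open and `S ⊆ O` with `O ∩ ∂S ≠ ∅`, `S` is a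
`k`-codimensional `C¹_ℍ`-regular submanifold with boundary in `O` if and only if `O ∩ S` is a
nonempty `k`-codimensional `C¹_ℍ`-regular submanifold and every `p ∈ O ∩ ∂S` admits a
neighbourhood `U` and `f₁,…,f_{k+1} ∈ C¹_ℍ(U)` with linearly independent horizontal gradients,
`U ∩ S = {f₁ = ⋯ = f_k = 0, f_{k+1} > 0}` and `f_{k+1}(p) = 0`. -/
theorem bdry_characterization {n : ℕ} (hn : 1 ≤ n) (D : HomDist n)
    (k : ℕ) (hk1 : 1 ≤ k) (hk2 : k ≤ n - 1)
    (O : Set (Hpt n)) (hO : IsOpen O) (S : Set (Hpt n)) (hSO : S ⊆ O)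
    (hbd : (O ∩ bdry S).Nonempty) :
    IsC1HSubWithBdry D k O S ↔
      ((O ∩ S).Nonempty ∧ IsC1HCodim k (O ∩ S) ∧
        ∀ p ∈ O ∩ bdry S, ∃ (U : Set (Hpt n)) (f : Fin (k+1) → Hpt n → ℝ),
          IsBdryFrame k S p U f) := by
  have hkn : k + 1 ≤ n := by omega
  have hOS : O ∩ S = S := inter_eq_right.2 hSO
  have hsub : ∀ A : Set (Hpt n), IsC1HSub k A ↔ IsC1HCodim k A := fun A => by
    unfold IsC1HSub; rw [if_pos (by omega)]
  have hsub' : ∀ A : Set (Hpt n), IsC1HSub (k+1) A ↔ IsC1HCodim (k+1) A := fun A => by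
    unfold IsC1HSub; rw [if_pos hkn]
  unfold IsC1HSubWithBdry
  simp only [hsub, hsub', hOS]
  constructor
  · rintro ⟨h1, h2, -, h4, h5⟩
    exact ⟨h1, h2, fun p hp => dir_one hn D hkn hO h2 h4 hp (h5 p hp)⟩
  · rintro ⟨h1, h2, h3⟩
    obtain ⟨h4, h5⟩ := dir_two hn D hkn hO h3
    exact ⟨h1, h2, hbd, h4, h5⟩

end Heis
end
end

section
/- Closure and boundary of a locally defined superlevel set: let 1 ≤ k ≤ n−1 and suppose that on an open set U ⊆ ℍ^n there are functions f₁,…,f_{k+1} ∈ C¹_ℍ(U) with ∇_ℍf₁,…,∇_ℍf_{k+1} linearly independent in U and a set S with U ∩ S = {q ∈ U : f₁(q)=⋯=f_k(q)=0, f_{k+1}(q)>0}. Then U ∩ S̄ = {q ∈ U : f₁(q)=⋯=f_k(q)=0, f_{k+1}(q) ≥ 0} and U ∩ ∂S = {q ∈ U : f₁(q)=⋯=f_{k+1}(q)=0}, where ∂S := S̄∖S; in particular U ∩ ∂S is a (k+1)-codimensional C¹_ℍ-regular submanifold. -/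
open MeasureTheory Topology Filter Set ENNReal

noncomputable section
namespace Heis

variable {n : ℕ}

lemma abs_deriv_le_aux {h : ℝ → ℝ} {d M : ℝ} (hd : HasDerivAt h d 0)
    (hM : ∀ᶠ s in 𝓝 (0:ℝ), h 0 - M * |s| ≤ h s) : |d| ≤ M := by
  have key : ∀ {g : ℝ → ℝ} {e : ℝ}, HasDerivAt g e 0 →
      (∀ᶠ s in 𝓝 (0:ℝ), g 0 - M * |s| ≤ g s) → -M ≤ e := by
    intro g e hg hge
    have h1 := hg.tendsto_slope.mono_left
      (nhdsWithin_mono (0:ℝ) (fun x (hx : x ∈ Ioi (0:ℝ)) => ne_of_gt hx))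
    refine ge_of_tendsto h1 ?_
    filter_upwards [hge.filter_mono nhdsWithin_le_nhds, self_mem_nhdsWithin] with s hs hs0
    have hs0 : 0 < s := hs0
    rw [abs_of_pos hs0] at hs
    rw [slope_def_field, le_div_iff₀ (by linarith)]
    linarith
  have h1 := key hd hM
  have hn : HasDerivAt (fun s => h (-s)) (-d) 0 := by
    have h0 : HasDerivAt h d (-(0:ℝ)) := by simpa using hd
    simpa [Function.comp_def] using HasDerivAt.comp (0:ℝ) h0 (hasDerivAt_neg (0:ℝ))
  have h2 := key hn (by
    have ht : Tendsto (fun s : ℝ => -s) (𝓝 0) (𝓝 0) := by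
      simpa using (continuous_neg (G := ℝ)).tendsto 0
    filter_upwards [ht.eventually hM] with s hs
    simpa using hs)
  rw [abs_le]; constructor <;> linarith

lemma frameVec_continuous (j : Fin (2*n+1)) : Continuous (fun p : Hpt n => frameVec j p) := by
  unfold frameVec
  split_ifs <;> fun_prop

lemma exists_nearby {m : ℕ} {U : Set (Hpt n)} (hU : IsOpen U) {f : Fin m → Hpt n → ℝ}
    (hf : ∀ i, IsC1H U (f i))
    (hind : ∀ q ∈ U, LinearIndependent ℝ (fun i => gradH (f i) q))
    {p : Hpt n} (hp : p ∈ U) (hfp : ∀ i, f i p = 0) (i₀ : Fin m) (R : ℝ) (hR : 0 < R) :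
    ∃ q ∈ U, dist q p < R ∧ (∀ i, i ≠ i₀ → f i q = 0) ∧ 0 < f i₀ q := by
  obtain ⟨r₁, hr₁, hr₁U⟩ := Metric.nhds_basis_closedBall.mem_iff.1 (hU.mem_nhds hp)
  set r := min r₁ R with hr
  have hr0 : 0 < r := lt_min hr₁ hR
  set K := Metric.closedBall p r with hK
  have hKU : K ⊆ U := (Metric.closedBall_subset_closedBall (min_le_left _ _)).trans hr₁U
  have hKc : IsCompact K := isCompact_closedBall p r
  have hpK : p ∈ K := Metric.mem_closedBall_self hr0.le
  -- the unit sphere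
  set Sp : Set (Fin m → ℝ) := {u | ∑ i, u i ^ 2 = 1} with hSp
  have hSpc : IsCompact Sp := by
    refine Metric.isCompact_of_isClosed_isBounded
      (isClosed_eq (by fun_prop) continuous_const) ?_
    refine (Metric.isBounded_closedBall (x := (0 : Fin m → ℝ)) (r := 1)).subset ?_
    intro u hu
    rw [mem_closedBall_zero_iff, pi_norm_le_iff_of_nonneg zero_le_one]
    intro i
    have h1 : u i ^ 2 ≤ ∑ i, u i ^ 2 :=
      Finset.single_le_sum (f := fun i => u i ^ 2) (fun i _ => sq_nonneg _) (Finset.mem_univ i)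
    have h2 : ∑ i, u i ^ 2 = 1 := hu
    rw [Real.norm_eq_abs, ← sq_le_one_iff_abs_le_one]; linarith
  have hSpne : Sp.Nonempty := ⟨Pi.single i₀ 1, by
    simp [hSp, Pi.single_apply]⟩
  let Φ : Hpt n × (Fin m → ℝ) → ℝ := fun z => ∑ j, |∑ i, z.2 i * gradH (f i) z.1 j|
  have hΦ : ContinuousOn Φ (K ×ˢ Sp) := by
    refine continuousOn_finsetSum _ fun j _ => ContinuousOn.abs ?_
    refine continuousOn_finsetSum _ fun i _ => ContinuousOn.mul (by fun_prop) ?_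
    exact ((hf i).contGrad j).comp continuousOn_fst fun z hz => hKU hz.1
  obtain ⟨z, hz, hzmin⟩ := (hKc.prod hSpc).exists_isMinOn (Set.Nonempty.prod ⟨p, hpK⟩ hSpne) hΦ
  have hc : 0 < Φ z := by
    have h0 : 0 ≤ Φ z := Finset.sum_nonneg fun _ _ => abs_nonneg _
    refine lt_of_le_of_ne h0 fun h => ?_
    have h1 := (Finset.sum_eq_zero_iff_of_nonneg (fun _ _ => abs_nonneg _)).1 h.symm
    have h2 := Fintype.linearIndependent_iff.1 (hind z.1 (hKU hz.1)) z.2 (by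
      ext j
      simpa using h1 j (Finset.mem_univ _))
    have h3 : ∑ i, z.2 i ^ 2 = 1 := hz.2
    simp [h2] at h3
  set c := Φ z with hcdef
  obtain ⟨B, hB⟩ := hKc.exists_bound_of_continuousOn
    (f := fun q : Hpt n => ∑ j : Fin (2*n), ‖frameVec (hIdx j) q‖)
    (continuous_finsetSum _ fun j _ => (frameVec_continuous _).norm).continuousOn
  have hB0 : 0 ≤ B := (norm_nonneg _).trans (hB p hpK)
  set ε := c / (B + 1) with hε
  have hε0 : 0 < ε := by positivity
  have hεB : ε * B < c := by
    rw [hε, div_mul_eq_mul_div, div_lt_iff₀ (by positivity)]; nlinarith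
  set η := ε * r / 2 with hη
  have hη0 : 0 < η := by positivity
  let v : Fin m → ℝ := Pi.single i₀ η
  let G : Hpt n → ℝ := fun q => ∑ i, (f i q - v i) ^ 2
  let φ : Hpt n → ℝ := fun q => √(G q) + ε * dist q p
  have hφ : ContinuousOn φ K := by
    refine ContinuousOn.add (ContinuousOn.sqrt ?_) (by fun_prop)
    exact continuousOn_finsetSum _ fun i _ =>
      ((((hf i).contOn.mono hKU)).sub continuousOn_const).pow 2
  obtain ⟨q, hqK, hqmin⟩ := hKc.exists_isMinOn ⟨p, hpK⟩ hφ
  have hGp : √(G p) = η := by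
    have : G p = η ^ 2 := by
      simp only [G, hfp, v, zero_sub, neg_sq, Pi.single_apply]
      simp
    rw [this, Real.sqrt_sq hη0.le]
  have hqp : φ q ≤ φ p := hqmin hpK
  have hqd : dist q p < r := by
    have h1 : √(G q) + ε * dist q p ≤ √(G p) + ε * dist p p := hqp
    rw [hGp, dist_self, mul_zero, add_zero] at h1
    have h2 := Real.sqrt_nonneg (G q)
    have h3 : ε * dist q p < ε * r := by nlinarith [mul_pos hε0 hr0]
    exact lt_of_mul_lt_mul_left h3 hε0.le
  have hGnn : ∀ q, 0 ≤ G q := fun q => Finset.sum_nonneg fun _ _ => sq_nonneg _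
  have hGq : G q = 0 := by
    by_contra hne
    have hGpos : 0 < G q := lt_of_le_of_ne (hGnn q) (Ne.symm hne)
    have hsp : 0 < √(G q) := Real.sqrt_pos.2 hGpos
    let u : Fin m → ℝ := fun i => (f i q - v i) / √(G q)
    have hu : u ∈ Sp := by
      change ∑ i, ((f i q - v i) / √(G q)) ^ 2 = 1
      simp only [div_pow, Real.sq_sqrt (hGnn q)]
      rw [← Finset.sum_div]
      exact div_self hne
    have hcle : c ≤ Φ (q, u) := hzmin (Set.mk_mem_prod hqK hu)
    have hj : ∀ j, |∑ i, u i * gradH (f i) q j| ≤ ε * ‖frameVec (hIdx j) q‖ := by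
      intro j
      set X := frameVec (hIdx j) q with hX
      have hder : ∀ i, HasDerivAt (fun s : ℝ => f i (q + s • X)) (gradH (f i) q j) 0 :=
        fun i => ((hf i).ldiff q (hKU hqK) j).hasLineDerivAt
      have hGd : HasDerivAt (fun s : ℝ => G (q + s • X))
          (∑ i, 2 * (f i q - v i) * gradH (f i) q j) 0 := by
        refine HasDerivAt.fun_sum fun i _ => ?_
        have := ((hder i).sub_const (v i)).fun_pow 2
        simpa using this
      have hsd := hGd.sqrt (by simpa using hne)
      have heq : (∑ i, 2 * (f i q - v i) * gradH (f i) q j) / (2 * √(G (q + (0:ℝ) • X)))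
          = ∑ i, u i * gradH (f i) q j := by
        simp only [zero_smul, add_zero, u]
        rw [Finset.sum_div]
        refine Finset.sum_congr rfl fun i _ => ?_
        field_simp
      rw [heq] at hsd
      refine abs_deriv_le_aux hsd ?_
      have hcont : Tendsto (fun s : ℝ => q + s • X) (𝓝 0) (𝓝 q) := by
        have : Continuous (fun s : ℝ => q + s • X) := by fun_prop
        simpa using this.tendsto 0
      filter_upwards [hcont.eventually (Metric.isOpen_ball.mem_nhds (Metric.mem_ball.2 hqd))]
        with s hs
      have h1 : φ q ≤ φ (q + s • X) := hqmin (Metric.ball_subset_closedBall hs)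
      have h2 : dist (q + s • X) p ≤ |s| * ‖X‖ + dist q p := by
        refine (dist_triangle _ q _).trans ?_
        rw [dist_eq_norm (q + s • X) q, add_sub_cancel_left, norm_smul, Real.norm_eq_abs]
      have h3 : √(G q) + ε * dist q p ≤ √(G (q + s • X)) + ε * dist (q + s • X) p := h1
      simp only [zero_smul, add_zero]
      have h4 := mul_le_mul_of_nonneg_left h2 hε0.le
      linarith
    have h5 : Φ (q, u) ≤ ε * ∑ j : Fin (2*n), ‖frameVec (hIdx j) q‖ := by
      rw [Finset.mul_sum]
      exact Finset.sum_le_sum fun j _ => hj j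
    have h6 := (le_abs_self _).trans (hB q hqK)
    have h7 := mul_le_mul_of_nonneg_left h6 hε0.le
    linarith
  have hfv : ∀ i, f i q = v i := by
    intro i
    have := (Finset.sum_eq_zero_iff_of_nonneg (fun i _ => sq_nonneg (f i q - v i))).1 hGq i
      (Finset.mem_univ i)
    exact sub_eq_zero.1 (pow_eq_zero_iff two_ne_zero |>.1 this)
  refine ⟨q, hKU hqK, hqd.trans_le (min_le_right _ _), fun i hi => ?_, ?_⟩
  · rw [hfv]; simp [v, hi]
  · rw [hfv]; simpa [v] using hη0

/-- **Closure and boundary of a locally defined superlevel set** (Remark 3.3): if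
`1 ≤ k ≤ n−1`, `f₁,…,f_{k+1} ∈ C¹_ℍ(U)` have linearly independent horizontal gradients on the
open set `U` and `U ∩ S = {f₁ = ⋯ = f_k = 0, f_{k+1} > 0}`, then
`U ∩ S̄ = {f₁ = ⋯ = f_k = 0, f_{k+1} ≥ 0}` and `U ∩ ∂S = {f₁ = ⋯ = f_{k+1} = 0}`; in
particular `U ∩ ∂S` is a `(k+1)`-codimensional `C¹_ℍ`-regular submanifold. -/
theorem closure_bdry_superlevel {n : ℕ} (hn : 1 ≤ n)
    (k : ℕ) (hk1 : 1 ≤ k) (hk2 : k ≤ n - 1)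
    (U : Set (Hpt n)) (hU : IsOpen U) (f : Fin (k+1) → Hpt n → ℝ)
    (hf : ∀ i, IsC1H U (f i))
    (hind : ∀ q ∈ U, LinearIndependent ℝ (fun i => gradH (f i) q))
    (S : Set (Hpt n))
    (hS : U ∩ S = {q ∈ U | (∀ i : Fin k, f i.castSucc q = 0) ∧ 0 < f (Fin.last k) q}) :
    U ∩ closure S = {q ∈ U | (∀ i : Fin k, f i.castSucc q = 0) ∧ 0 ≤ f (Fin.last k) q} ∧
    U ∩ bdry S = {q ∈ U | ∀ i, f i q = 0} ∧
    IsC1HCodim (k+1) (U ∩ bdry S) := by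
  have hScl : U ∩ closure S = {q ∈ U | (∀ i : Fin k, f i.castSucc q = 0) ∧ 0 ≤ f (Fin.last k) q} := by
    ext q
    constructor
    · rintro ⟨hqU, hqS⟩
      have hq : q ∈ closure (U ∩ S) := hU.inter_closure ⟨hqU, hqS⟩
      have hc : ∀ i, ContinuousWithinAt (f i) (U ∩ S) q := fun i =>
        ((hf i).contOn q hqU).mono inter_subset_left
      refine ⟨hqU, fun i => ?_, ?_⟩
      · have := (hc i.castSucc).mem_closure (t := {0}) hq fun x hx => by
          rw [hS] at hx; exact hx.2.1 i
        simpa using this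
      · have := (hc (Fin.last k)).mem_closure (t := Ici 0) hq fun x hx => by
          rw [hS] at hx; exact hx.2.2.le
        simpa using this
    · rintro ⟨hqU, h0, h1⟩
      refine ⟨hqU, ?_⟩
      rcases h1.lt_or_eq with h1 | h1
      · have : q ∈ U ∩ S := by rw [hS]; exact ⟨hqU, h0, h1⟩
        exact subset_closure this.2
      · rw [Metric.mem_closure_iff]
        intro R hR
        obtain ⟨x, hxU, hxd, hx0, hx1⟩ := exists_nearby hU hf hind hqU
          (fun i => Fin.lastCases h1.symm h0 i) (Fin.last k) R hR
        have : x ∈ U ∩ S := by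
          rw [hS]
          exact ⟨hxU, fun i => hx0 _ (Fin.castSucc_lt_last i).ne, hx1⟩
        exact ⟨x, this.2, by rwa [dist_comm]⟩
  have hbd : U ∩ bdry S = {q ∈ U | ∀ i, f i q = 0} := by
    ext q
    constructor
    · rintro ⟨hqU, hqc, hqS⟩
      have h : q ∈ U ∩ closure S := ⟨hqU, hqc⟩
      rw [hScl] at h
      refine ⟨hqU, fun i => Fin.lastCases ?_ h.2.1 i⟩
      by_contra hne
      have : q ∈ U ∩ S := by
        rw [hS]; exact ⟨hqU, h.2.1, lt_of_le_of_ne h.2.2 (Ne.symm hne)⟩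
      exact hqS this.2
    · rintro ⟨hqU, h0⟩
      have h : q ∈ U ∩ closure S := by
        rw [hScl]; exact ⟨hqU, fun i => h0 _, (h0 _).ge⟩
      refine ⟨hqU, h.2, fun hqS => ?_⟩
      have h' : q ∈ U ∩ S := ⟨hqU, hqS⟩
      rw [hS] at h'
      exact h'.2.2.ne' (h0 _)
  refine ⟨hScl, hbd, fun p hp => ⟨U, hU, hp.1, f, hf, hind, ?_⟩⟩
  rw [inter_assoc, inter_comm (bdry S) U, ← inter_assoc, inter_self, hbd]

end Heis
end
end
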